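/- arXiv:2312.06548 — 4 statements merged into one kernel-verified Lean document; each statement's English description precedes it below -/
import Mathlib

section
/- Let α ∈ (0,1) be an irrational number whose continued fraction expansion α = [0; a_1, a_2, …] satisfies limsup_{i→∞} a_i ≤ 3. Then liminf_{N→∞} P_N(α) > 0 and limsup_{N→∞} P_N(α)/N < ∞. -/
/-- The Gauss map `x ↦ {1/x}`. -/
noncomputable def gaussMap (x : ℝ) : ℝ := Int.fract x⁻¹

/-- `pq α i` is the `i`-th partial quotient `aᵢ` of the continued fraction
expansion `α = [0; a₁, a₂, …]` of an irrational `α ∈ (0,1)` (meaningful for `i ≥ 1`). -/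
noncomputable def pq (α : ℝ) (i : ℕ) : ℕ := ⌊(gaussMap^[i - 1] α)⁻¹⌋₊

/-- The Sudler product `P_N(α) = ∏_{r=1}^N 2|sin(π r α)|`. -/
noncomputable def sudler (α : ℝ) (N : ℕ) : ℝ :=
  ∏ r ∈ Finset.Icc 1 N, 2 * |Real.sin (Real.pi * r * α)|

namespace Sudler

open Filter Topology Set

/-- The logarithm of the Gamma function. -/
noncomputable def logGamma (x : ℝ) : ℝ := Real.log (Real.Gamma x)

theorem logGamma_add_one {x : ℝ} (hx : 0 < x) : logGamma (x + 1) = logGamma x + Real.log x := by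
  unfold logGamma
  rw [Real.Gamma_add_one hx.ne', Real.log_mul hx.ne' (Real.Gamma_pos_of_pos hx).ne', add_comm]

theorem convexOn_logGamma : ConvexOn ℝ (Ioi 0) logGamma := Real.convexOn_log_Gamma

@[simp] theorem logGamma_one : logGamma 1 = 0 := by simp [logGamma]

@[simp] theorem logGamma_two : logGamma 2 = 0 := by simp [logGamma]

theorem logGamma_nonpos {x : ℝ} (h1 : 1 ≤ x) (h2 : x ≤ 2) : logGamma x ≤ 0 := by
  have h := convexOn_logGamma.2 (show (1 : ℝ) ∈ Ioi 0 by simp) (show (2 : ℝ) ∈ Ioi 0 by simp)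
    (show 0 ≤ 2 - x by linarith) (show 0 ≤ x - 1 by linarith) (by ring)
  simp only [smul_eq_mul, logGamma_one, logGamma_two] at h
  rw [show (2 - x) * 1 + (x - 1) * 2 = x by ring] at h
  linarith

/-- The value `-logGamma (3 / 2)`. -/
noncomputable def gapConst : ℝ := Real.log 2 - Real.log Real.pi / 2

theorem logGamma_three_halves : logGamma (3 / 2) = -gapConst := by
  have : (3 / 2 : ℝ) = 1 / 2 + 1 := by norm_num
  rw [this, logGamma_add_one (by norm_num)]
  unfold logGamma gapConst
  rw [Real.Gamma_one_half_eq, Real.log_sqrt Real.pi_pos.le, one_div, Real.log_inv]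
  ring

/-- Reflection formula. -/
theorem logGamma_one_add_add_one_sub {y : ℝ} (h0 : 0 < y) (h1 : y < 1) :
    logGamma (1 + y) + logGamma (1 - y) =
      Real.log (Real.pi * y / Real.sin (Real.pi * y)) := by
  have hs : 0 < Real.sin (Real.pi * y) :=
    Real.sin_pos_of_pos_of_lt_pi (by positivity) (by nlinarith [Real.pi_pos])
  have h := Real.Gamma_mul_Gamma_one_sub y
  rw [add_comm 1 y, logGamma_add_one h0]
  unfold logGamma
  rw [add_right_comm, ← Real.log_mul (Real.Gamma_pos_of_pos h0).ne'
    (Real.Gamma_pos_of_pos (by linarith)).ne', h, ← Real.log_mul (by positivity) h0.ne']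
  congr 1
  field_simp

/-- Partial products converging to `logGamma`. -/
theorem tendsto_logGammaSeq {x : ℝ} (hx : 0 < x) :
    Tendsto (Real.BohrMollerup.logGammaSeq x) atTop (𝓝 (logGamma x)) :=
  Real.BohrMollerup.tendsto_log_gamma hx

/-- The leading terms of Stirling's expansion of `logGamma (x + 1)`. -/
noncomputable def stirling (x : ℝ) : ℝ :=
  (x + 1 / 2) * Real.log x - x + Real.log (2 * Real.pi) / 2

theorem tendsto_logFactorial_sub_stirling :
    Tendsto (fun n : ℕ => Real.log (n.factorial : ℝ) - stirling n) atTop (𝓝 0) := by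
  have h := (Stirling.tendsto_stirlingSeq_sqrt_pi).log (by positivity)
  have h2 := h.sub_const (Real.log (√Real.pi))
  rw [sub_self] at h2
  refine h2.congr' ?_
  filter_upwards [eventually_gt_atTop 0] with n hn
  have hn' : (0 : ℝ) < n := by exact_mod_cast hn
  rw [Stirling.log_stirlingSeq_formula, Real.log_sqrt Real.pi_pos.le, stirling,
    Real.log_mul (by norm_num) hn'.ne', Real.log_div hn'.ne' (Real.exp_pos 1).ne', Real.log_exp,
    Real.log_mul (by norm_num) Real.pi_pos.ne']
  ring

theorem logGamma_succ (n : ℕ) : logGamma (n + 1) = Real.log (n.factorial : ℝ) := by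
  rw [logGamma, Real.Gamma_nat_eq_factorial]

theorem logGamma_add_le {x s : ℝ} (hx : 0 < x) (hs : 0 ≤ s) (hs1 : s ≤ 1) :
    logGamma (x + s) ≤ logGamma x + s * Real.log x := by
  have h := convexOn_logGamma.2 (show x ∈ Ioi 0 from hx)
    (show x + 1 ∈ Ioi 0 by simp; linarith)
    (show 0 ≤ 1 - s by linarith) hs (by ring)
  simp only [smul_eq_mul] at h
  rw [show (1 - s) * x + s * (x + 1) = x + s by ring, logGamma_add_one hx] at h
  linarith

theorem le_logGamma_add {x s : ℝ} (hx : 0 < x) (hs : 0 ≤ s) :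
    logGamma (x + 1) + s * Real.log x ≤ logGamma (x + 1 + s) := by
  have h := convexOn_logGamma.2 (show x ∈ Ioi 0 from hx)
    (show x + 1 + s ∈ Ioi 0 by simp; linarith)
    (show 0 ≤ s / (1 + s) by positivity) (show 0 ≤ 1 / (1 + s) by positivity)
    (by field_simp; ring)
  simp only [smul_eq_mul] at h
  rw [show s / (1 + s) * x + 1 / (1 + s) * (x + 1 + s) = x + 1 by field_simp; ring] at h
  have h3 := logGamma_add_one hx
  rw [← sub_nonneg] at h
  have : 0 ≤ (1 + s) * (s / (1 + s) * logGamma x + 1 / (1 + s) * logGamma (x + 1 + s)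
      - logGamma (x + 1)) := by positivity
  field_simp at this
  rw [h3] at this ⊢
  linarith

theorem stirling_add_sub_le {x s : ℝ} (hx : 0 < x) (hs : 0 ≤ s) (hs1 : s ≤ 1) :
    |stirling (x + s) - stirling x - s * Real.log x| ≤ 2 / x := by
  have hl : Real.log (x + s) - Real.log x = Real.log (1 + s / x) := by
    rw [← Real.log_div (by positivity) hx.ne']; congr 1; field_simp
  have h1 : Real.log (1 + s / x) ≤ s / x := by
    have := Real.log_le_sub_one_of_pos (show 0 < 1 + s / x by positivity)
    linarith
  have h2 : s / (x + s) ≤ Real.log (1 + s / x) := by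
    have := Real.one_sub_inv_le_log_of_pos (show 0 < 1 + s / x by positivity)
    refine le_trans (le_of_eq ?_) this
    field_simp; ring
  have e : stirling (x + s) - stirling x - s * Real.log x =
      (x + s + 1 / 2) * Real.log (1 + s / x) - s := by
    unfold stirling
    rw [← hl]; ring
  rw [e, abs_le]
  have a1 : (x + s + 1 / 2) * Real.log (1 + s / x) ≤ (x + s + 1 / 2) * (s / x) := by gcongr
  have a2 : (x + s + 1 / 2) * (s / (x + s)) ≤ (x + s + 1 / 2) * Real.log (1 + s / x) := by gcongr
  have b1 : (x + s + 1 / 2) * (s / x) - s = s * (s + 1 / 2) / x := by field_simp; ring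
  have b2 : s * (s + 1 / 2) / x ≤ 2 / x := by gcongr; nlinarith
  have b3 : (x + s + 1 / 2) * (s / (x + s)) - s = s / 2 / (x + s) := by field_simp; ring
  have b4 : 0 ≤ s / 2 / (x + s) := by positivity
  have b5 : 0 ≤ 2 / x := by positivity
  constructor <;> linarith

theorem tendsto_logGamma_sub_stirling :
    Tendsto (fun x : ℝ => logGamma (x + 1) - stirling x) atTop (𝓝 0) := by
  have hfl : Tendsto (fun x : ℝ => ⌊x⌋₊) atTop atTop := tendsto_nat_floor_atTop
  have t1 := tendsto_logFactorial_sub_stirling.comp hfl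
  have hfl' : Tendsto (fun x : ℝ => (⌊x⌋₊ : ℝ)) atTop atTop := tendsto_natCast_atTop_atTop.comp hfl
  have t2 : Tendsto (fun x : ℝ => 4 / (⌊x⌋₊ : ℝ)) atTop (𝓝 0) := hfl'.const_div_atTop 4
  have t3 : Tendsto (fun x : ℝ => (logGamma (x + 1) - stirling x) -
      (Real.log ((⌊x⌋₊).factorial : ℝ) - stirling ⌊x⌋₊)) atTop (𝓝 0) := by
    refine squeeze_zero_norm' ?_ t2
    filter_upwards [eventually_ge_atTop 1] with x hx
    obtain ⟨n, hn⟩ : ∃ n : ℕ, ⌊x⌋₊ = n := ⟨_, rfl⟩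
    have hn1 : 1 ≤ n := by rw [← hn]; exact Nat.le_floor (by simpa using hx)
    have hn0 : (0 : ℝ) < n := by exact_mod_cast hn1
    have hnx : (n : ℝ) ≤ x := by rw [← hn]; exact Nat.floor_le (by linarith)
    have hxn : x < n + 1 := by rw [← hn]; exact Nat.lt_floor_add_one x
    rw [hn, ← logGamma_succ]
    obtain ⟨s, rfl⟩ : ∃ s, x = n + s := ⟨x - n, by ring⟩
    have q1 := stirling_add_sub_le hn0 (show 0 ≤ s by linarith) (by linarith)
    have q2 := logGamma_add_le (show (0 : ℝ) < n + 1 by linarith) (show 0 ≤ s by linarith)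
      (by linarith)
    have q3 := le_logGamma_add hn0 (show 0 ≤ s by linarith)
    have q4 : Real.log (n + 1) - Real.log n ≤ 1 / n := by
      rw [← Real.log_div (by positivity) hn0.ne']
      refine (Real.log_le_sub_one_of_pos (by positivity)).trans (le_of_eq ?_)
      field_simp; ring
    have q5 : s * (Real.log (n + 1) - Real.log n) ≤ 1 / n := by
      have : 0 ≤ 1 / (n : ℝ) := by positivity
      nlinarith
    rw [show (n : ℝ) + s + 1 = n + 1 + s by ring, Real.norm_eq_abs]
    rw [abs_le] at q1 ⊢
    have e2 : (4 : ℝ) / n = 4 * (1 / n) := by ring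
    have e3 : (2 : ℝ) / n = 2 * (1 / n) := by ring
    have : 0 ≤ 1 / (n : ℝ) := by positivity
    rw [e2]
    rw [e3] at q1
    constructor <;> nlinarith
  have := t3.add t1
  simpa [Function.comp_def] using this

theorem tendsto_stirling_add (c : ℝ) :
    Tendsto (fun x : ℝ => stirling (x + c) - stirling x - c * Real.log x) atTop (𝓝 0) := by
  have h1 : Tendsto (fun x : ℝ => x * Real.log (1 + c / x)) atTop (𝓝 c) :=
    Real.tendsto_mul_log_one_add_div_atTop c
  have h2 : Tendsto (fun x : ℝ => Real.log (1 + c / x)) atTop (𝓝 0) := by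
    have : Tendsto (fun x : ℝ => 1 + c / x) atTop (𝓝 (1 + 0)) :=
      tendsto_const_nhds.add (tendsto_id.const_div_atTop c)
    have h := this.log (by norm_num)
    simpa using h
  have h3 := (h1.add (h2.const_mul (c + 1 / 2))).sub_const c
  rw [mul_zero, add_zero, sub_self] at h3
  refine h3.congr' ?_
  filter_upwards [eventually_gt_atTop 0, eventually_gt_atTop (-c)] with x hx hxc
  have hl : Real.log (x + c) - Real.log x = Real.log (1 + c / x) := by
    rw [← Real.log_div (by linarith) hx.ne']; congr 1; field_simp
  unfold stirling
  rw [← hl]; ring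

theorem tendsto_logGamma_add_sub_stirling (c : ℝ) :
    Tendsto (fun x : ℝ => logGamma (x + 1 + c) - stirling x - c * Real.log x) atTop (𝓝 0) := by
  have h := (tendsto_logGamma_sub_stirling.comp (tendsto_atTop_add_const_right _ c tendsto_id)).add
    (tendsto_stirling_add c)
  rw [add_zero] at h
  refine h.congr fun x => ?_
  simp only [Function.comp, id]
  rw [show x + c + 1 = x + 1 + c by ring]; ring

/-- Concavity on `[0, T)` together with a chord-type bound near the origin. -/
structure Tame (T : ℝ) (f : ℝ → ℝ) : Prop where
  concave : ConcaveOn ℝ (Ico 0 T) f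
  le_chord : ∀ t, 0 ≤ t → t ≤ 1 → 3 * f t ≤ t * (8 * f (1 / 2) - f 1)

theorem Tame.congr {T : ℝ} {f g : ℝ → ℝ} (hT : 1 < T) (hf : Tame T f)
    (h : ∀ z ∈ Ico 0 T, f z = g z) : Tame T g where
  concave := hf.concave.congr h
  le_chord t h0 h1 := by
    rw [← h t ⟨h0, by linarith⟩, ← h (1 / 2) ⟨by norm_num, by linarith⟩,
      ← h 1 ⟨by norm_num, by linarith⟩]
    exact hf.le_chord t h0 h1

theorem Tame.add {T : ℝ} {f g : ℝ → ℝ} (hf : Tame T f) (hg : Tame T g) :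
    Tame T (fun z => f z + g z) where
  concave := hf.concave.add hg.concave
  le_chord t h0 h1 := by
    have := hf.le_chord t h0 h1
    have := hg.le_chord t h0 h1
    linarith

theorem tame_linear (T c : ℝ) : Tame T (fun z => c * z) where
  concave := ⟨convex_Ico 0 T, fun x _ y _ a b _ _ _ => by
    simp only [smul_eq_mul]; exact le_of_eq (by ring)⟩
  le_chord t h0 h1 := le_of_eq (by ring)

theorem Tame.sum {T : ℝ} {f : ℕ → ℝ → ℝ} (s : ℕ) (hf : ∀ m, Tame T (f m)) :
    Tame T (fun z => ∑ m ∈ Finset.range s, f m z) := by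
  induction s with
  | zero => simpa using tame_linear T 0
  | succ s ih => simpa only [Finset.sum_range_succ] using ih.add (hf s)

theorem Tame.of_tendsto {T : ℝ} {f : ℕ → ℝ → ℝ} {g : ℝ → ℝ} (hT : 1 < T)
    (hf : ∀ m, Tame T (f m))
    (h : ∀ z ∈ Ico 0 T, Tendsto (fun m => f m z) atTop (𝓝 (g z))) : Tame T g where
  concave := ⟨convex_Ico 0 T, fun x hx y hy a b ha hb hab =>
    le_of_tendsto_of_tendsto'
      (((h x hx).const_smul a).add ((h y hy).const_smul b))
      (h _ (convex_Ico 0 T hx hy ha hb hab))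
      fun m => (hf m).concave.2 hx hy ha hb hab⟩
  le_chord t h0 h1 :=
    le_of_tendsto_of_tendsto' ((h t ⟨h0, by linarith⟩).const_mul 3)
      ((((h (1 / 2) ⟨by norm_num, by linarith⟩).const_mul 8).sub
        (h 1 ⟨by norm_num, by linarith⟩)).const_mul t)
      fun m => (hf m).le_chord t h0 h1

theorem hasSum_log_sub_log_neg {c z : ℝ} (h0 : 0 ≤ z) (h1 : z < c) :
    HasSum (fun k : ℕ => -(2 * (1 / (2 * k + 1)) * (z / c) ^ (2 * k + 1)))
      (Real.log (c - z) - Real.log (c + z)) := by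
  have hc : 0 < c := by linarith
  have h : |z / c| < 1 := by
    rw [abs_of_nonneg (by positivity), div_lt_one hc]; exact h1
  have e : Real.log (c - z) - Real.log (c + z) =
      -(Real.log (1 + z / c) - Real.log (1 - z / c)) := by
    rw [show 1 + z / c = (c + z) / c by field_simp, show 1 - z / c = (c - z) / c by field_simp,
      Real.log_div (by linarith) hc.ne', Real.log_div (by linarith) hc.ne']
    ring
  rw [e]
  exact (Real.hasSum_log_sub_log_of_abs_lt_one h).neg

theorem tame_log {T c : ℝ} (hT : 1 < T) (hc : T ≤ c) :
    Tame T (fun z => Real.log (c - z) - Real.log (c + z)) where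
  concave := by
    refine ⟨convex_Ico 0 T, fun x hx y hy a b ha hb hab => ?_⟩
    have hz := convex_Ico 0 T hx hy ha hb hab
    refine hasSum_le (fun k => ?_)
      (((hasSum_log_sub_log_neg hx.1 (hx.2.trans_le hc)).const_smul a).add
        ((hasSum_log_sub_log_neg hy.1 (hy.2.trans_le hc)).const_smul b))
      (hasSum_log_sub_log_neg hz.1 (hz.2.trans_le hc))
    have hc0 : 0 < c := by linarith
    have h := (convexOn_pow (𝕜 := ℝ) (2 * k + 1)).2
      (show x / c ∈ Ici 0 from div_nonneg hx.1 hc0.le)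
      (show y / c ∈ Ici 0 from div_nonneg hy.1 hc0.le) ha hb hab
    simp only [smul_eq_mul] at h ⊢
    rw [show (a * x + b * y) / c = a * (x / c) + b * (y / c) by ring]
    have hk : (0 : ℝ) ≤ 2 * (1 / (2 * k + 1)) := by positivity
    nlinarith [mul_le_mul_of_nonneg_left h hk]
  le_chord t h0 h1 := by
    have hc0 : 0 < c := by linarith
    refine hasSum_le (fun k => ?_)
      ((hasSum_log_sub_log_neg h0 (by linarith)).mul_left 3)
      ((((hasSum_log_sub_log_neg (show (0 : ℝ) ≤ 1 / 2 by norm_num) (by linarith)).mul_left 8).sub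
        (hasSum_log_sub_log_neg (show (0 : ℝ) ≤ 1 by norm_num) (by linarith))).mul_left t)
    simp only [div_pow]
    have hk : (0 : ℝ) ≤ 2 * (1 / (2 * k + 1)) / c ^ (2 * k + 1) := by positivity
    have key : t * (8 * (1 ^ (2 * k + 1) / 2 ^ (2 * k + 1)) - 1) ≤ 3 * t ^ (2 * k + 1) := by
      rcases k with _ | k
      · norm_num; linarith
      · have h8 : (8 : ℝ) ≤ 2 ^ (2 * (k + 1) + 1) := by
          calc (8 : ℝ) = 2 ^ 3 := by norm_num
            _ ≤ _ := pow_le_pow_right₀ (by norm_num) (by omega)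
        have : 8 * ((1 : ℝ) ^ (2 * (k + 1) + 1) / 2 ^ (2 * (k + 1) + 1)) ≤ 1 := by
          rw [one_pow, mul_one_div, div_le_one (by positivity)]; exact h8
        have h3 : 0 ≤ t ^ (2 * (k + 1) + 1) := by positivity
        nlinarith
    have := mul_le_mul_of_nonneg_left key hk
    simp only [one_pow] at this ⊢
    refine le_trans (le_of_eq ?_) (le_trans (neg_le_neg this) (le_of_eq ?_)) <;> ring

theorem tame_logGamma {T B : ℝ} (hT : 1 < T) (hB : T ≤ B) :
    Tame T (fun z => logGamma (B + z) - logGamma (B - z)) := by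
  refine Tame.of_tendsto (f := fun n z => Real.BohrMollerup.logGammaSeq (B + z) n -
    Real.BohrMollerup.logGammaSeq (B - z) n) hT (fun n => ?_) fun z hz =>
      (tendsto_logGammaSeq (by linarith [hz.1])).sub (tendsto_logGammaSeq (by linarith [hz.2]))
  have h := (tame_linear T (2 * Real.log n)).add
    (Tame.sum (f := fun m z => Real.log ((B + m) - z) - Real.log ((B + m) + z)) (n + 1)
      fun m => tame_log hT (by have : (0 : ℝ) ≤ m := m.cast_nonneg
                               linarith))
  convert h using 2 with z
  unfold Real.BohrMollerup.logGammaSeq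
  rw [Finset.sum_sub_distrib]
  simp only [show ∀ m : ℕ, B + m - z = B - z + m from fun m => by ring,
    show ∀ m : ℕ, B + m + z = B + z + m from fun m => by ring]
  ring

/-- The normalising slope of `rowSum`. -/
noncomputable def rowSlope (α : ℝ) (M : ℕ) : ℝ :=
  2 * Real.log (M.factorial : ℝ) - 2 * M * Real.log α + α * Real.log M

/-- One row of the double product: ratio of Gamma functions centred at `(m + 1) / α + 1`. -/
noncomputable def row (α : ℝ) (m : ℕ) (z : ℝ) : ℝ :=
  logGamma ((m + 1) / α + 1 + z) - logGamma ((m + 1) / α + 1 - z)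

/-- Renormalised finite sum of rows. -/
noncomputable def rowSum (α : ℝ) (M : ℕ) (z : ℝ) : ℝ :=
  ∑ m ∈ Finset.range M, row α m z - rowSlope α M * z

/-- The limit of the renormalised row sums. -/
noncomputable def rowLimit (α z : ℝ) : ℝ := limUnder atTop fun M => rowSum α M z

theorem rowSum_neg (α : ℝ) (M : ℕ) (z : ℝ) : rowSum α M (-z) = -rowSum α M z := by
  unfold rowSum row
  have : ∀ m : ℕ, logGamma ((m + 1) / α + 1 + -z) - logGamma ((m + 1) / α + 1 - -z) =
    -(logGamma ((m + 1) / α + 1 + z) - logGamma ((m + 1) / α + 1 - z)) := fun m => by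
      rw [← sub_eq_add_neg, sub_neg_eq_add]; ring
  simp only [this, Finset.sum_neg_distrib]
  ring

@[simp] theorem rowSum_zero (α : ℝ) (M : ℕ) : rowSum α M 0 = 0 := by simp [rowSum, row]

section

variable {α : ℝ}

theorem tame_row (h0 : 0 < α) (m : ℕ) : Tame (1 / α + 1) (row α m) := by
  have : 0 < 1 / α := by positivity
  refine tame_logGamma (by linarith) ?_
  gcongr
  have : (0 : ℝ) ≤ m := m.cast_nonneg
  linarith

theorem tame_rowSum (h0 : 0 < α) (M : ℕ) : Tame (1 / α + 1) (rowSum α M) := by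
  have := (Tame.sum M (tame_row h0)).add (tame_linear _ (-rowSlope α M))
  convert this using 2 with z
  unfold rowSum; ring

theorem row_add_one_sub (h0 : 0 < α) (m : ℕ) {z : ℝ} (hl : -1 - 1 / α < z) (hu : z < 1 / α) :
    row α m (z + 1) - row α m z = Real.log (1 + α * z + α + m) + Real.log (1 - α * z + m)
      - 2 * Real.log α := by
  have hm : 1 / α ≤ (m + 1) / α := by
    gcongr; have : (0 : ℝ) ≤ m := m.cast_nonneg
    linarith
  have e1 := logGamma_add_one (x := (m + 1) / α + 1 + z) (by linarith)
  have e2 := logGamma_add_one (x := (m + 1) / α - z) (by linarith)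
  unfold row
  rw [show (m + 1) / α + 1 + (z + 1) = (m + 1) / α + 1 + z + 1 by ring, e1,
    show (m + 1) / α + 1 - z = (m + 1) / α - z + 1 by ring, e2,
    show (m + 1) / α + 1 - (z + 1) = (m + 1) / α - z by ring,
    show 1 + α * z + α + m = α * ((m + 1) / α + 1 + z) by field_simp; ring,
    show 1 - α * z + m = α * ((m + 1) / α - z) by field_simp; ring,
    Real.log_mul h0.ne' (by linarith), Real.log_mul h0.ne' (by linarith)]
  ring

theorem tendsto_rowSum_add_one_sub (h0 : 0 < α) {z : ℝ} (hl : -1 - 1 / α < z) (hu : z < 1 / α) :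
    Tendsto (fun M => rowSum α M (z + 1) - rowSum α M z) atTop
      (𝓝 (-logGamma (1 - α * z) - logGamma (1 + α * z + α))) := by
  rw [← tendsto_add_atTop_iff_nat 1]
  have p1 : 0 < 1 - α * z := by
    have := mul_lt_mul_of_pos_left hu h0
    rw [mul_one_div_cancel h0.ne'] at this; linarith
  have p2 : 0 < 1 + α * z + α := by
    have := mul_lt_mul_of_pos_left hl h0
    rw [mul_sub, mul_one_div_cancel h0.ne'] at this; linarith
  have t1 := (tendsto_logGammaSeq p1).neg.sub (tendsto_logGammaSeq p2)
  have t2 : Tendsto (fun n : ℕ => Real.log ((n + 1 : ℕ) : ℝ) - Real.log n) atTop (𝓝 0) := by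
    simpa using Real.tendsto_log_nat_add_one_sub_log
  have t3 := t1.sub (t2.const_mul (2 + α))
  rw [mul_zero, sub_zero] at t3
  refine t3.congr fun n => ?_
  unfold rowSum
  have : ∑ m ∈ Finset.range (n + 1), row α m (z + 1) - ∑ m ∈ Finset.range (n + 1), row α m z =
      ∑ m ∈ Finset.range (n + 1), Real.log (1 + α * z + α + m) +
      ∑ m ∈ Finset.range (n + 1), Real.log (1 - α * z + m) - (n + 1) * (2 * Real.log α) := by
    rw [← Finset.sum_sub_distrib, Finset.sum_congr rfl fun m _ => row_add_one_sub h0 m hl hu,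
      Finset.sum_sub_distrib, Finset.sum_add_distrib]
    simp
  unfold Real.BohrMollerup.logGammaSeq rowSlope
  have hf : Real.log ((n + 1).factorial : ℝ) = Real.log ((n + 1 : ℕ) : ℝ) +
      Real.log (n.factorial : ℝ) := by
    rw [Nat.factorial_succ, Nat.cast_mul, Real.log_mul (by positivity) (by positivity)]
  rw [hf]
  have hn : ((n + 1 : ℕ) : ℝ) = n + 1 := by push_cast; ring
  linear_combination (norm := (rw [hn]; ring)) -this

/-- The points at which the row sums are known to converge. -/
def RowConv (α z : ℝ) : Prop := ∃ l, Tendsto (fun M => rowSum α M z) atTop (𝓝 l)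

theorem RowConv.add_one (h0 : 0 < α) {z : ℝ} (hl : -1 - 1 / α < z) (hu : z < 1 / α)
    (h : RowConv α z) : RowConv α (z + 1) := by
  obtain ⟨l, hl'⟩ := h
  exact ⟨_, ((tendsto_rowSum_add_one_sub h0 hl hu).add hl').congr fun M => by ring⟩

theorem rowConv_zero : RowConv α 0 := ⟨0, by simp⟩

theorem rowConv_of_mem_Icc (h0 : 0 < α) (h1 : α < 1) {z : ℝ} (hz0 : 0 ≤ z) (hz1 : z ≤ 1) :
    RowConv α z := by
  have hT : 1 < 1 / α := by rw [lt_div_iff₀ h0]; linarith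
  obtain ⟨l1, c1⟩ : RowConv α 1 := by
    simpa using rowConv_zero.add_one h0 (z := 0) (by linarith) (by linarith)
  obtain ⟨l2, c2⟩ : RowConv α 2 := by
    have := RowConv.add_one h0 (z := 1) (by linarith) (by linarith) ⟨l1, c1⟩
    rwa [one_add_one_eq_two] at this
  have hmono : Monotone fun M => rowSum α M z - z * rowSum α M 1 := by
    refine monotone_nat_of_le_succ fun M => ?_
    have hr := (tame_row h0 M).concave.2 (x := 0) (y := 1) ⟨le_rfl, by linarith⟩
      ⟨by norm_num, by linarith⟩ (show 0 ≤ 1 - z by linarith) hz0 (by ring)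
    have hr0 : row α M 0 = 0 := by simp [row]
    simp only [smul_eq_mul, hr0, mul_zero, zero_add, mul_one] at hr
    have hs : ∀ w, rowSum α (M + 1) w - rowSum α M w =
        row α M w - (rowSlope α (M + 1) - rowSlope α M) * w := fun w => by
      unfold rowSum; rw [Finset.sum_range_succ]; ring
    have := hs z
    have := hs 1
    nlinarith
  have hbdd : BddAbove (range fun M => rowSum α M z - z * rowSum α M 1) := by
    have c3 := (c1.const_mul (2 - 2 * z)).sub (c2.const_mul (1 - z))
    obtain ⟨b, hb⟩ := c3.bddAbove_range
    refine ⟨b, ?_⟩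
    rintro _ ⟨M, rfl⟩
    refine le_trans ?_ (hb ⟨M, rfl⟩)
    have hp : 0 < 2 - z := by linarith
    have hc := (tame_rowSum h0 M).concave.2 (x := z) (y := 2) ⟨hz0, by linarith⟩
      ⟨by norm_num, by linarith⟩ (show 0 ≤ 1 / (2 - z) by positivity)
      (show 0 ≤ (1 - z) / (2 - z) from div_nonneg (by linarith) hp.le)
      (by field_simp; ring)
    simp only [smul_eq_mul] at hc
    rw [show 1 / (2 - z) * z + (1 - z) / (2 - z) * 2 = 1 by field_simp; ring] at hc
    have h3 := mul_le_mul_of_nonneg_left hc hp.le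
    have e : (2 - z) * (1 / (2 - z) * rowSum α M z + (1 - z) / (2 - z) * rowSum α M 2) =
      rowSum α M z + (1 - z) * rowSum α M 2 := by field_simp
    rw [e] at h3
    simp only
    linarith
  have c := tendsto_atTop_ciSup hmono hbdd
  exact ⟨_, (c.add (c1.const_mul z)).congr fun M => by ring⟩

theorem rowConv_of_nonneg (h0 : 0 < α) (h1 : α < 1) {z : ℝ} (hz0 : 0 ≤ z) (hz : z < 1 / α + 1) :
    RowConv α z := by
  obtain ⟨k, hk⟩ := exists_nat_ge z
  induction k generalizing z with
  | zero => exact rowConv_of_mem_Icc h0 h1 hz0 (by simp at hk; linarith)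
  | succ k ih =>
    rcases le_total z 1 with h | h
    · exact rowConv_of_mem_Icc h0 h1 hz0 h
    · have : 0 < 1 / α := by positivity
      have := RowConv.add_one h0 (z := z - 1) (by linarith) (by linarith)
        (ih (by linarith) (by linarith) (by push_cast at hk; linarith))
      rwa [sub_add_cancel] at this

theorem rowConv_of_abs_lt (h0 : 0 < α) (h1 : α < 1) {z : ℝ} (hl : -(1 / α + 1) < z)
    (hu : z < 1 / α + 1) : RowConv α z := by
  rcases le_total 0 z with h | h
  · exact rowConv_of_nonneg h0 h1 h hu
  · obtain ⟨l, hl'⟩ := rowConv_of_nonneg h0 h1 (z := -z) (by linarith) (by linarith)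
    exact ⟨-l, hl'.neg.congr fun M => by rw [rowSum_neg, neg_neg]⟩

theorem tendsto_rowSum (h0 : 0 < α) (h1 : α < 1) {z : ℝ} (hl : -(1 / α + 1) < z)
    (hu : z < 1 / α + 1) : Tendsto (fun M => rowSum α M z) atTop (𝓝 (rowLimit α z)) :=
  tendsto_nhds_limUnder (rowConv_of_abs_lt h0 h1 hl hu)

theorem tame_rowLimit (h0 : 0 < α) (h1 : α < 1) : Tame (1 / α + 1) (rowLimit α) := by
  have : 0 < 1 / α := by positivity
  exact Tame.of_tendsto (by linarith) (tame_rowSum h0) fun z hz =>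
    tendsto_rowSum h0 h1 (by linarith [hz.1]) hz.2

theorem rowLimit_zero : rowLimit α 0 = 0 := by
  unfold rowLimit; simp only [rowSum_zero]; exact tendsto_const_nhds.limUnder_eq

theorem rowLimit_neg (h0 : 0 < α) (h1 : α < 1) {z : ℝ} (hl : -(1 / α + 1) < z)
    (hu : z < 1 / α + 1) : rowLimit α (-z) = -rowLimit α z := by
  have h := tendsto_rowSum h0 h1 (z := -z) (by linarith) (by linarith)
  simp only [rowSum_neg] at h
  exact tendsto_nhds_unique h (tendsto_rowSum h0 h1 hl hu).neg

theorem rowLimit_add_one (h0 : 0 < α) (h1 : α < 1) {z : ℝ} (hl : -1 - 1 / α < z)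
    (hu : z < 1 / α) :
    rowLimit α (z + 1) = rowLimit α z - logGamma (1 - α * z) - logGamma (1 + α * z + α) := by
  have h := tendsto_nhds_unique (tendsto_rowSum_add_one_sub h0 hl hu)
    ((tendsto_rowSum h0 h1 (z := z + 1) (by linarith) (by linarith)).sub
      (tendsto_rowSum h0 h1 (z := z) (by linarith) (by linarith)))
  linarith

theorem rowSum_add_period_sub (h0 : 0 < α) (M : ℕ) (z : ℝ) :
    rowSum α M (z + 1 / α) - rowSum α M z =
      logGamma (M / α + 1 + (1 / α + z)) + logGamma (M / α + 1 + (-z)) - logGamma (1 / α + 1 + z)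
        - logGamma (1 - z) - rowSlope α M / α := by
  have : ∀ M : ℕ, ∑ m ∈ Finset.range M, row α m (z + 1 / α) - ∑ m ∈ Finset.range M, row α m z =
      logGamma (M / α + 1 + (1 / α + z)) + logGamma (M / α + 1 + (-z)) - logGamma (1 / α + 1 + z)
        - logGamma (1 - z) := by
    intro M
    induction M with
    | zero => simp [show 1 + (α⁻¹ + z) = α⁻¹ + 1 + z by ring, ← sub_eq_add_neg]
    | succ M ih =>
      rw [Finset.sum_range_succ, Finset.sum_range_succ]
      have e1 : row α M (z + 1 / α) = logGamma (((M + 1 : ℕ) : ℝ) / α + 1 + (1 / α + z)) -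
        logGamma (M / α + 1 + (-z)) := by
        unfold row
        congr 2 <;> push_cast <;> field_simp <;> ring
      have e2 : row α M z = logGamma (M / α + 1 + (1 / α + z)) -
        logGamma (((M + 1 : ℕ) : ℝ) / α + 1 + (-z)) := by
        unfold row
        congr 2 <;> push_cast <;> field_simp <;> ring
      linarith
  unfold rowSum
  rw [← this M]
  field_simp
  ring

theorem rowLimit_add_period (h0 : 0 < α) (h1 : α < 1) {z : ℝ} (hl : -(1 / α + 1) < z)
    (hu : z < 1) :
    rowLimit α (z + 1 / α) = rowLimit α z - logGamma (1 / α + 1 + z) - logGamma (1 - z) +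
      Real.log (2 * Real.pi / α) - 1 / α * Real.log (2 * Real.pi * α) := by
  have hp : 0 < 1 / α := by positivity
  have hB : Tendsto (fun M : ℕ => (M : ℝ) / α) atTop atTop :=
    tendsto_natCast_atTop_atTop.atTop_div_const h0
  have s1 := (tendsto_logGamma_add_sub_stirling (1 / α + z)).comp hB
  have s2 := (tendsto_logGamma_add_sub_stirling (-z)).comp hB
  have s3 := (tendsto_logFactorial_sub_stirling).const_mul (2 / α)
  have s := ((s1.add s2).sub s3).add_const (Real.log (2 * Real.pi / α) -
    1 / α * Real.log (2 * Real.pi * α) - logGamma (1 / α + 1 + z) - logGamma (1 - z))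
  simp only [add_zero, mul_zero, sub_zero, zero_add] at s
  have c := (tendsto_rowSum h0 h1 (z := z + 1 / α) (by linarith) (by linarith)).sub
    (tendsto_rowSum h0 h1 (z := z) hl (by linarith))
  suffices h : _ from (eq_add_of_sub_eq (tendsto_nhds_unique c (s.congr' h))).trans (by ring)
  filter_upwards [eventually_gt_atTop 0] with M hM
  have hM' : (0 : ℝ) < M := by exact_mod_cast hM
  rw [rowSum_add_period_sub h0]
  unfold rowSlope stirling
  simp only [Function.comp]
  rw [Real.log_div hM'.ne' h0.ne', Real.log_div (by positivity) h0.ne',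
    Real.log_mul (by positivity) h0.ne']
  field_simp
  ring

end

/-- `log |1 - e^{2πit}|`. -/
noncomputable def logChord (t : ℝ) : ℝ := Real.log (2 * |Real.sin (Real.pi * t)|)

theorem logChord_neg (t : ℝ) : logChord (-t) = logChord t := by
  unfold logChord; rw [mul_neg, Real.sin_neg, abs_neg]

theorem logChord_add_int (t : ℝ) (k : ℤ) : logChord (t + k) = logChord t := by
  unfold logChord
  rw [mul_add, mul_comm Real.pi (k : ℝ), Real.sin_add_int_mul_pi, abs_mul, abs_zpow, abs_neg,
    abs_one, one_zpow, one_mul]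

theorem logChord_of_pos {t : ℝ} (h0 : 0 < t) (h1 : t < 1) :
    logChord t = Real.log (2 * Real.sin (Real.pi * t)) := by
  unfold logChord
  rw [abs_of_pos (Real.sin_pos_of_pos_of_lt_pi (by positivity) (by nlinarith [Real.pi_pos]))]

theorem logGamma_reflection {y : ℝ} (h0 : 0 < y) (h1 : y < 1) :
    logGamma (1 + y) + logGamma (1 - y) = Real.log (2 * Real.pi * y) - logChord y := by
  have hs : 0 < Real.sin (Real.pi * y) :=
    Real.sin_pos_of_pos_of_lt_pi (by positivity) (by nlinarith [Real.pi_pos])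
  rw [logGamma_one_add_add_one_sub h0 h1, logChord_of_pos h0 h1, Real.log_div (by positivity)
    hs.ne', Real.log_mul two_ne_zero hs.ne', mul_assoc, Real.log_mul two_ne_zero (by positivity)]
  ring

/-- The logarithm of the transition factor relating products for `α` and for its Gauss image. -/
noncomputable def logFactor (α z : ℝ) : ℝ :=
  z * Real.log (2 * Real.pi * α) + logGamma (1 + z) - logGamma (1 - α * z) + rowLimit α z

theorem logFactor_zero (α : ℝ) : logFactor α 0 = 0 := by simp [logFactor, rowLimit_zero]

section

variable {α : ℝ}

theorem logFactor_add_one (h0 : 0 < α) (h1 : α < 1) {z : ℝ} (hl : -1 < z) (hu : z + 1 < 1 / α) :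
    logFactor α (z + 1) = logFactor α z + logChord (α * (z + 1)) := by
  have hp : 0 < 1 / α := by positivity
  have hy1 : α * (z + 1) < 1 := by
    have := mul_lt_mul_of_pos_left hu h0
    rwa [mul_one_div_cancel h0.ne'] at this
  have hz1 : 0 < z + 1 := by linarith
  have hr := logGamma_reflection (y := α * (z + 1)) (by positivity) hy1
  unfold logFactor
  rw [rowLimit_add_one h0 h1 (by linarith) (by linarith), show 1 + (z + 1) = (1 + z) + 1 by ring,
    logGamma_add_one (by linarith)]
  rw [← mul_assoc, Real.log_mul (by positivity) hz1.ne'] at hr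
  rw [show 1 + α * z + α = 1 + α * (z + 1) by ring, add_comm 1 z] at *
  linarith

theorem logFactor_add_period (h0 : 0 < α) (h1 : α < 1) {z : ℝ} (hl : -1 < z) (hu : z < 0) :
    logFactor α (z + 1 / α) = logFactor α z + logChord z := by
  have hp : 0 < 1 / α := by positivity
  have hr := logGamma_reflection (y := -z) (by linarith) (by linarith)
  rw [logChord_neg] at hr
  have hg := logGamma_add_one (x := -(α * z)) (by nlinarith)
  unfold logFactor
  rw [rowLimit_add_period h0 h1 (by linarith) (by linarith),
    show 1 - α * (z + 1 / α) = -(α * z) by field_simp; ring,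
    show 1 - α * z = -(α * z) + 1 by ring, hg, show 1 + (z + 1 / α) = 1 / α + 1 + z by ring,
    show -(α * z) = α * (-z) by ring, Real.log_mul h0.ne' (by linarith),
    Real.log_div (by positivity) h0.ne']
  rw [Real.log_mul (by positivity) (by linarith), sub_neg_eq_add, ← sub_eq_add_neg] at hr
  linarith

theorem logFactor_add_neg (h0 : 0 < α) (h1 : α < 1) {z : ℝ} (hz : z ≠ 0) (hz1 : |z| < 1) :
    logFactor α z + logFactor α (-z) = logChord (α * z) - logChord z - Real.log α := by
  wlog h : 0 < z generalizing z
  · have := this (z := -z) (neg_ne_zero.2 hz) (by rwa [abs_neg])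
      (neg_pos.2 (lt_of_le_of_ne (not_lt.1 h) hz))
    rw [neg_neg, mul_neg, logChord_neg, logChord_neg] at this
    linarith
  rw [abs_of_pos h] at hz1
  have hp : 0 < 1 / α := by positivity
  have r1 := logGamma_reflection h hz1
  have r2 := logGamma_reflection (y := α * z) (by positivity) (by nlinarith)
  rw [Real.log_mul (by positivity) h.ne'] at r1
  rw [← mul_assoc, Real.log_mul (by positivity) h.ne', Real.log_mul (by positivity) h0.ne'] at r2
  unfold logFactor
  rw [rowLimit_neg h0 h1 (by linarith) (by linarith), mul_neg, sub_neg_eq_add,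
    show 1 + -z = 1 - z by ring]
  linarith

end

/-- The logarithm of the shifted Sudler product `∏_{r ≤ N} 2 |sin π (r α + θ)|`. -/
noncomputable def logShift (α θ : ℝ) (N : ℕ) : ℝ :=
  ∑ r ∈ Finset.range N, logChord ((r + 1) * α + θ)

theorem logShift_succ (α θ : ℝ) (N : ℕ) :
    logShift α θ (N + 1) = logShift α θ N + logChord ((N + 1) * α + θ) :=
  Finset.sum_range_succ _ _

@[simp] theorem logShift_zero (α θ : ℝ) : logShift α θ 0 = 0 := rfl

/-- Renormalisation of shifted Sudler products under the Gauss map. -/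
theorem logShift_sub_logShift {α α' θ θ' : ℝ} {a : ℕ} (h0 : 0 < α) (h1 : α < 1)
    (hα : α * (a + α') = 1) (hθ : θ' * α = -θ) (hl : -α < θ) (hu : θ < 1) {N M : ℕ}
    (hxl : -α < N * α + θ - M) (hxu : N * α + θ - M < 1)
    (hne : ∀ n m : ℕ, n ≤ N → (n : ℝ) * α + θ = m → n = 0 ∧ m = 0) :
    logShift α θ N - logShift α' θ' M =
      logFactor α ((N * α + θ - M) / α) - logFactor α (θ / α) := by
  induction hk : N + M generalizing N M with
  | zero =>
    obtain ⟨rfl, rfl⟩ : N = 0 ∧ M = 0 := by omega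
    simp
  | succ k ih =>
    rcases lt_trichotomy (N * α + θ - M) 0 with hx | hx | hx
    · obtain ⟨M, rfl⟩ : ∃ M', M = M' + 1 := by
        refine Nat.exists_eq_succ_of_ne_zero ?_
        rintro rfl
        obtain ⟨N, rfl⟩ := Nat.exists_eq_succ_of_ne_zero (show N ≠ 0 by omega)
        have : 0 ≤ (N : ℝ) * α := by positivity
        push_cast at hx
        linarith
      push_cast at hx hxl hxu ⊢
      have h := ih (N := N) (M := M) (by linarith) (by linarith) hne (by omega)
      set x := N * α + θ - (M + 1) with hxdef
      have hz := logFactor_add_period (z := x / α) h0 h1 (by rw [lt_div_iff₀ h0]; linarith)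
        (div_neg_of_neg_of_pos hx h0)
      rw [← add_div, show x + 1 = N * α + θ - M by rw [hxdef]; ring] at hz
      have hc : logChord ((M + 1) * α' + θ') = logChord (x / α) := by
        rw [← logChord_neg (x / α), ← logChord_add_int _ (((M + 1) * a - N : ℤ))]
        congr 1
        have : α' = 1 / α - a := by field_simp; linarith
        rw [this]
        have : θ' = -θ / α := by field_simp; linarith
        rw [this, hxdef]
        push_cast
        field_simp
        ring
      rw [logShift_succ, hc]
      linarith
    · have := hne N M le_rfl (by linarith)
      omega
    · obtain ⟨N, rfl⟩ : ∃ N', N = N' + 1 := by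
        refine Nat.exists_eq_succ_of_ne_zero ?_
        rintro rfl
        obtain ⟨M, rfl⟩ := Nat.exists_eq_succ_of_ne_zero (show M ≠ 0 by omega)
        have : 0 ≤ (M : ℝ) := by positivity
        push_cast at hx
        linarith
      push_cast at hx hxl hxu ⊢
      have h := ih (N := N) (M := M) (by linarith) (by linarith)
        (fun n m hn => hne n m (by omega)) (by omega)
      set x := (N + 1) * α + θ - M with hxdef
      have hz := logFactor_add_one (z := (N * α + θ - M) / α) h0 h1
        (by rw [lt_div_iff₀ h0]; linarith) (by
          rw [div_add_one h0.ne']; gcongr; linarith)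
      have e : (N * α + θ - M) / α + 1 = x / α := by rw [hxdef]; field_simp; ring
      rw [e] at hz
      have hc : logChord ((N + 1) * α + θ) = logChord (α * (x / α)) := by
        rw [mul_div_cancel₀ _ h0.ne', ← logChord_add_int x M, hxdef]
        congr 1; push_cast; ring
      rw [logShift_succ, hc]
      linarith

theorem div_le_log {y : ℝ} {p q : ℕ} (hy : 0 < y) (hq : 0 < q)
    (h : (2.7182818286 : ℝ) ^ p ≤ y ^ q) : (p / q : ℝ) ≤ Real.log y := by
  have hq' : (0 : ℝ) < q := by exact_mod_cast hq
  rw [div_le_iff₀ hq', mul_comm, ← Real.log_pow, Real.le_log_iff_exp_le (by positivity),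
    ← mul_one (p : ℝ), Real.exp_nat_mul]
  exact (pow_le_pow_left₀ (Real.exp_pos 1).le Real.exp_one_lt_d9.le p).trans h

theorem log_le_div {y : ℝ} {p q : ℕ} (hy : 0 < y) (hq : 0 < q)
    (h : y ^ q ≤ (2.7182818283 : ℝ) ^ p) : Real.log y ≤ (p / q : ℝ) := by
  have hq' : (0 : ℝ) < q := by exact_mod_cast hq
  rw [le_div_iff₀ hq', mul_comm, ← Real.log_pow, Real.log_le_iff_le_exp (by positivity),
    ← mul_one (p : ℝ), Real.exp_nat_mul]
  exact h.trans (pow_le_pow_left₀ (by norm_num) Real.exp_one_gt_d9.le p)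

/-- Lower bound for `log` from the tangent to `log` of the reciprocal. -/
theorem log_add_one_sub_div_le {c y : ℝ} (hc : 0 < c) (hy : 0 < y) :
    Real.log c + 1 - c / y ≤ Real.log y := by
  have := Real.one_sub_inv_le_log_of_pos (show 0 < y / c by positivity)
  rw [Real.log_div hy.ne' hc.ne', inv_div] at this
  linarith

theorem gapConst_eq : 2 * gapConst = Real.log (4 / Real.pi) := by
  rw [Real.log_div (by norm_num) Real.pi_pos.ne', show (4 : ℝ) = 2 ^ 2 by norm_num, Real.log_pow,
    gapConst]
  push_cast; ring

theorem le_gapConst : 3 / 25 ≤ gapConst := by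
  have h : ((6 : ℕ) / (25 : ℕ) : ℝ) ≤ Real.log (4 / Real.pi) := by
    refine div_le_log (by positivity) (by norm_num) ?_
    have : (4 / 3.1416 : ℝ) ≤ 4 / Real.pi := by gcongr; exact Real.pi_lt_d4.le
    refine le_trans ?_ (pow_le_pow_left₀ (by norm_num) this 25)
    norm_num
  rw [← gapConst_eq] at h
  push_cast at h
  linarith

theorem gapConst_le : gapConst ≤ 4 / 33 := by
  have h : Real.log (4 / Real.pi) ≤ ((8 : ℕ) / (33 : ℕ) : ℝ) := by
    refine log_le_div (by positivity) (by norm_num) ?_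
    have : 4 / Real.pi ≤ (4 / 3.1415 : ℝ) := by gcongr; exact Real.pi_gt_d4.le
    refine (pow_le_pow_left₀ (by positivity) this 33).trans ?_
    norm_num
  rw [← gapConst_eq] at h
  push_cast at h
  linarith

theorem logGamma_one_add_le {α : ℝ} (h0 : 0 ≤ α) (h1 : α ≤ 1 / 2) :
    logGamma (1 + α) ≤ -2 * gapConst * α := by
  have h := convexOn_logGamma.2 (show (1 : ℝ) ∈ Ioi 0 by simp)
    (show (3 / 2 : ℝ) ∈ Ioi 0 by simp) (show 0 ≤ 1 - 2 * α by linarith)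
    (show 0 ≤ 2 * α by linarith) (by ring)
  simp only [smul_eq_mul, logGamma_one, logGamma_three_halves] at h
  rw [show (1 - 2 * α) * 1 + 2 * α * (3 / 2) = 1 + α by ring] at h
  linarith

theorem le_logGamma_one_add_half {α : ℝ} (h0 : 0 ≤ α) (h1 : α ≤ 1) :
    -gapConst * (2 - α) ≤ logGamma (1 + α / 2) := by
  have hp : 0 < 2 - α := by linarith
  have h := convexOn_logGamma.2 (show 1 + α / 2 ∈ Ioi (0 : ℝ) by simp; linarith)
    (show (2 : ℝ) ∈ Ioi 0 by simp) (show 0 ≤ 1 / (2 - α) by positivity)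
    (show 0 ≤ (1 - α) / (2 - α) from div_nonneg (by linarith) hp.le) (by field_simp; ring)
  simp only [smul_eq_mul, logGamma_two, mul_zero, add_zero] at h
  rw [show 1 / (2 - α) * (1 + α / 2) + (1 - α) / (2 - α) * 2 = 3 / 2 by field_simp; ring,
    logGamma_three_halves, one_div, inv_mul_eq_div, le_div_iff₀ hp] at h
  linarith

theorem two_mul_le_sin_pi_mul {y : ℝ} (h0 : 0 ≤ y) (h1 : y ≤ 1 / 2) :
    2 * y ≤ Real.sin (Real.pi * y) := by
  have h := Real.mul_le_sin (x := Real.pi * y) (by positivity) (by nlinarith [Real.pi_pos])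
  refine le_trans (le_of_eq ?_) h
  have := Real.pi_pos
  field_simp

section RowLimitValues

variable {α : ℝ}

theorem rowLimit_one (h0 : 0 < α) (h1 : α < 1) : rowLimit α 1 = -logGamma (1 + α) := by
  have hp : 0 < 1 / α := by positivity
  have := rowLimit_add_one h0 h1 (z := 0) (by linarith) hp
  simpa [rowLimit_zero] using this

theorem rowLimit_half (h0 : 0 < α) (h1 : α < 1) :
    rowLimit α (1 / 2) = -logGamma (1 + α / 2) := by
  have hp : 1 < 1 / α := by rw [lt_div_iff₀ h0]; linarith
  have h := rowLimit_add_one h0 h1 (z := -(1 / 2)) (by linarith) (by linarith)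
  rw [rowLimit_neg h0 h1 (by linarith) (by linarith)] at h
  rw [show -(1 / 2 : ℝ) + 1 = 1 / 2 by norm_num,
    show 1 - α * -(1 / 2) = 1 + α / 2 by ring, show 1 + α * -(1 / 2) + α = 1 + α / 2 by ring] at h
  linarith

theorem rowLimit_two (h0 : 0 < α) (h1 : α < 1) :
    rowLimit α 2 = -logGamma (1 + α) - logGamma (1 - α) - logGamma (1 + 2 * α) := by
  have hp : 1 < 1 / α := by rw [lt_div_iff₀ h0]; linarith
  have h := rowLimit_add_one h0 h1 (z := 1) (by linarith) hp
  rw [rowLimit_one h0 h1, one_add_one_eq_two, mul_one, add_assoc, ← two_mul] at h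
  exact h

theorem rowLimit_three (h0 : 0 < α) (h1 : α < 1 / 2) :
    rowLimit α 3 = rowLimit α 2 - logGamma (1 - 2 * α) - logGamma (1 + 3 * α) := by
  have hp : 2 < 1 / α := by rw [lt_div_iff₀ h0]; linarith
  have h := rowLimit_add_one h0 (by linarith) (z := 2) (by linarith) hp
  rw [show (2 : ℝ) + 1 = 3 by norm_num, show 1 - α * 2 = 1 - 2 * α by ring,
    show 1 + α * 2 + α = 1 + 3 * α by ring] at h
  exact h

theorem rowLimit_inv (h0 : 0 < α) (h1 : α < 1) :
    rowLimit α (1 / α) = -logGamma (1 / α + 1) +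
      Real.log (2 * Real.pi / α) - 1 / α * Real.log (2 * Real.pi * α) := by
  have hp : 0 < 1 / α := by positivity
  have h := rowLimit_add_period h0 h1 (z := 0) (by linarith) (by norm_num)
  simpa [rowLimit_zero] using h

end RowLimitValues

/-- Quotient data of one step of the Gauss map with digit at most three. -/
structure Step (a : ℕ) (α α' : ℝ) : Prop where
  one_le : 1 ≤ a
  le_three : a ≤ 3
  mul_eq : α * (a + α') = 1
  lower : 5 / 19 ≤ α
  upper : α ≤ 19 / 24
  lower' : 5 / 19 ≤ α'
  upper' : α' ≤ 19 / 24

theorem logGamma_sub_eq_sum {z : ℝ} {b : ℕ} (hz : (b : ℝ) - 1 < z) :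
    logGamma (1 + z) = logGamma (1 + z - b) + ∑ i ∈ Finset.range b, Real.log (z - i) := by
  induction b with
  | zero => simp
  | succ b ih =>
    push_cast at hz ⊢
    rw [ih (by linarith), Finset.sum_range_succ, show 1 + z - b = (1 + z - (b + 1)) + 1 by ring,
      logGamma_add_one (by linarith), show 1 + z - ((b : ℝ) + 1) = z - b by ring]
    ring

/-- Concave minorant used in the step inequality for the digit `b`. -/
noncomputable def stepFun (α : ℝ) (b : ℕ) (z : ℝ) : ℝ :=
  ∑ i ∈ Finset.range b, Real.log (z - i) + z * (Real.log (2 * Real.pi * α) - 2 * α) + rowLimit α z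

theorem concaveOn_sum_log (b : ℕ) :
    ConcaveOn ℝ (Ici (b : ℝ)) fun z => ∑ i ∈ Finset.range b, Real.log (z - i) := by
  refine ⟨convex_Ici _, fun x hx y hy s t hs ht hst => ?_⟩
  rw [Finset.smul_sum, Finset.smul_sum, ← Finset.sum_add_distrib]
  refine Finset.sum_le_sum fun i hi => ?_
  have hib : (i : ℝ) + 1 ≤ b := by exact_mod_cast Finset.mem_range.1 hi
  simp only [mem_Ici] at hx hy
  have h := (strictConcaveOn_log_Ioi.concaveOn).2 (show x - i ∈ Ioi (0 : ℝ) by simp; linarith)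
    (show y - i ∈ Ioi (0 : ℝ) by simp; linarith) hs ht hst
  refine h.trans (le_of_eq ?_)
  congr 1
  simp only [smul_eq_mul]
  linear_combination (-(i : ℝ)) * hst

theorem concaveOn_stepFun {α : ℝ} (h0 : 0 < α) (h1 : α < 1) (b : ℕ) :
    ConcaveOn ℝ (Icc (b : ℝ) (1 / α)) (stepFun α b) := by
  have c1 := (concaveOn_sum_log b).subset
    (show Icc (b : ℝ) (1 / α) ⊆ _ from Icc_subset_Ici_self) (convex_Icc _ _)
  have c2 := (tame_rowLimit h0 h1).concave.subset
    (show Icc (b : ℝ) (1 / α) ⊆ _ from fun z hz => ⟨(Nat.cast_nonneg b).trans hz.1, by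
      linarith [hz.2]⟩) (convex_Icc _ _)
  have c3 : ConcaveOn ℝ (Icc (b : ℝ) (1 / α))
      fun z => z * (Real.log (2 * Real.pi * α) - 2 * α) :=
    ⟨convex_Icc _ _, fun x _ y _ s t _ _ _ => by
      simp only [smul_eq_mul]; exact le_of_eq (by ring)⟩
  exact (c1.add c3).add c2

theorem stepFun_succ_self (α : ℝ) (b : ℕ) :
    stepFun α (b + 1) ((b + 1 : ℕ) : ℝ) = stepFun α b ((b + 1 : ℕ) : ℝ) := by
  unfold stepFun
  rw [Finset.sum_range_succ]
  simp

theorem stepFun_nonneg_of_endpoints {α : ℝ} (h0 : 0 < α) (h1 : α < 1) {b : ℕ} {u z : ℝ}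
    (hb : (b : ℝ) ≤ z) (hz : z ≤ u) (hu : u ≤ 1 / α) (hl : 0 ≤ stepFun α b b)
    (hr : 0 ≤ stepFun α b u) : 0 ≤ stepFun α b z :=
  (le_min hl hr).trans <| (concaveOn_stepFun h0 h1 b).min_le_of_mem_Icc
    ⟨le_rfl, (hb.trans hz).trans hu⟩ ⟨hb.trans hz, hu⟩ ⟨hb, hz⟩

namespace Step

variable {a : ℕ} {α α' : ℝ} (hs : Step a α α')
include hs

theorem pos : 0 < α := by linarith [hs.lower]
theorem lt_one : α < 1 := by linarith [hs.upper]
theorem inv_eq : 1 / α = a + α' := by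
  rw [div_eq_iff hs.pos.ne', mul_comm]; exact hs.mul_eq.symm

theorem mul_le_one {b : ℕ} (hb : b ≤ a) : b * α ≤ 1 := by
  have h : (b : ℝ) ≤ a := by exact_mod_cast hb
  nlinarith [hs.mul_eq, hs.pos, hs.lower']

end Step

theorem stepFun_one_nonneg {a : ℕ} {α α' : ℝ} (hs : Step a α α') : 0 ≤ stepFun α 1 1 := by
  have h0 := hs.pos
  have hl := hs.lower
  have hu := hs.upper
  have hpi := Real.pi_gt_d4
  suffices h : logGamma (1 + α) ≤ Real.log (2 * Real.pi * α) - 2 * α by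
    simp [stepFun, rowLimit_one h0 hs.lt_one]; linarith
  rcases le_total α (1 / 2) with h2 | h2
  · have hg := logGamma_one_add_le h0.le h2
    have hc := le_gapConst
    have ht := log_add_one_sub_div_le (c := 0.6 * Real.pi) (y := 2 * Real.pi * α)
      (by positivity) (by positivity)
    have hn : ((17 : ℕ) / (27 : ℕ) : ℝ) ≤ Real.log (0.6 * Real.pi) := by
      refine div_le_log (by positivity) (by norm_num) ?_
      refine le_trans ?_ (pow_le_pow_left₀ (show (0 : ℝ) ≤ 0.6 * 3.1415 by norm_num)
        (by linarith) 27)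
      norm_num
    push_cast at hn
    have e : 0.6 * Real.pi / (2 * Real.pi * α) = 0.3 / α := by field_simp; norm_num
    rw [e] at ht
    have hq : 0 ≤ 1 + 17 / 27 - 0.3 / α - 1.76 * α := by
      have : 1 + 17 / 27 - 0.3 / α - 1.76 * α = ((1 + 17 / 27) * α - 0.3 - 1.76 * α ^ 2) / α := by
        field_simp
      rw [this]
      refine div_nonneg ?_ h0.le
      nlinarith
    nlinarith
  · have hg := logGamma_nonpos (x := 1 + α) (by linarith) (by linarith)
    have ht := log_add_one_sub_div_le (c := 19 / 12 * Real.pi) (y := 2 * Real.pi * α)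
      (by positivity) (by positivity)
    have hn : ((8 : ℕ) / (5 : ℕ) : ℝ) ≤ Real.log (19 / 12 * Real.pi) := by
      refine div_le_log (by positivity) (by norm_num) ?_
      refine le_trans ?_ (pow_le_pow_left₀ (show (0 : ℝ) ≤ 19 / 12 * 3.1415 by norm_num)
        (by linarith) 5)
      norm_num
    push_cast at hn
    have e : 19 / 12 * Real.pi / (2 * Real.pi * α) = (19 / 24) / α := by field_simp; norm_num
    rw [e] at ht
    have hq : 0 ≤ 1 + 8 / 5 - (19 / 24) / α - 2 * α := by
      have : 1 + 8 / 5 - (19 / 24) / α - 2 * α = ((1 + 8 / 5) * α - 19 / 24 - 2 * α ^ 2) / α := by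
        field_simp
      rw [this]
      refine div_nonneg ?_ h0.le
      nlinarith
    linarith

theorem log_four_mul_le_logChord {y : ℝ} (h0 : 0 < y) (h1 : y ≤ 1 / 2) :
    Real.log (4 * y) ≤ logChord y := by
  rw [logChord_of_pos h0 (by linarith)]
  exact Real.log_le_log (by positivity) (by linarith [two_mul_le_sin_pi_mul h0.le h1])

theorem stepFun_two_nonneg {a : ℕ} {α α' : ℝ} (hs : Step a α α') (ha : 2 ≤ a) :
    0 ≤ stepFun α 2 2 := by
  have h0 := hs.pos
  have hl := hs.lower
  have hu := hs.mul_le_one ha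
  push_cast at hu
  have hpi := Real.pi_gt_d4
  have hg := logGamma_nonpos (x := 1 + 2 * α) (by linarith) (by linarith)
  have hr := logGamma_reflection h0 hs.lt_one
  have hc := log_four_mul_le_logChord h0 (by linarith)
  have e : stepFun α 2 2 = Real.log 2 + 2 * (Real.log (2 * Real.pi * α) - 2 * α) +
      rowLimit α 2 := by
    unfold stepFun
    norm_num [Finset.sum_range_succ]
  rw [e, rowLimit_two h0 hs.lt_one]
  have hn : ((8 : ℕ) / (7 : ℕ) : ℝ) ≤ Real.log Real.pi := by
    refine div_le_log (by positivity) (by norm_num) ?_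
    refine le_trans ?_ (pow_le_pow_left₀ (show (0 : ℝ) ≤ 3.1415 by norm_num) hpi.le 7)
    norm_num
  push_cast at hn
  have ht := log_add_one_sub_div_le (c := 1) (y := 4 * α) (by positivity) (by positivity)
  rw [Real.log_one] at ht
  have hl2 : Real.log 2 + Real.log (2 * Real.pi * α) = Real.log Real.pi + Real.log (4 * α) := by
    rw [← Real.log_mul (by positivity) (by positivity), ← Real.log_mul (by positivity)
      (by positivity)]
    congr 1; ring
  have hq : 0 ≤ 8 / 7 + 2 * (1 - 1 / (4 * α)) - 4 * α := by
    have : 8 / 7 + 2 * (1 - 1 / (4 * α)) - 4 * α =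
      ((8 / 7 + 2) * α - 1 / 2 - 4 * α ^ 2) / α := by field_simp; ring
    rw [this]
    refine div_nonneg ?_ h0.le
    nlinarith
  linarith

theorem stepFun_three_nonneg {a : ℕ} {α α' : ℝ} (hs : Step a α α') (ha : 3 ≤ a) :
    0 ≤ stepFun α 3 3 := by
  have h0 := hs.pos
  have hl := hs.lower
  have hu := hs.mul_le_one ha
  push_cast at hu
  have hpi := Real.pi_gt_d4
  have hg := logGamma_nonpos (x := 1 + 3 * α) (by linarith) (by linarith)
  have hr := logGamma_reflection h0 hs.lt_one
  have hr2 := logGamma_reflection (y := 2 * α) (by linarith) (by linarith)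
  have hc := log_four_mul_le_logChord h0 (by linarith)
  have hc2 : Real.log (4 / 3) ≤ logChord (2 * α) := by
    have : logChord (2 * α) = logChord (1 - 2 * α) := by
      rw [← logChord_neg (1 - 2 * α), ← logChord_add_int _ (-1 : ℤ)]
      congr 1; push_cast; ring
    rw [this]
    refine (Real.log_le_log (by norm_num) ?_).trans
      (log_four_mul_le_logChord (by linarith) (by linarith))
    linarith
  have e : stepFun α 3 3 = Real.log 3 + Real.log 2 + 3 * (Real.log (2 * Real.pi * α) - 2 * α) +
      rowLimit α 3 := by
    unfold stepFun
    norm_num [Finset.sum_range_succ]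
  rw [e, rowLimit_three h0 (by linarith), rowLimit_two h0 hs.lt_one]
  have hn : ((23 : ℕ) / (10 : ℕ) : ℝ) ≤ Real.log (32 / 9 * Real.pi) := by
    refine div_le_log (by positivity) (by norm_num) ?_
    refine le_trans ?_ (pow_le_pow_left₀ (show (0 : ℝ) ≤ 11 by norm_num)
      (by linarith) 10)
    norm_num
  push_cast at hn
  have ht := log_add_one_sub_div_le (c := 1) (y := 3 * α) (by positivity) (by positivity)
  rw [Real.log_one] at ht
  have hl2 : Real.log 3 + Real.log 2 + Real.log (2 * Real.pi * α) + Real.log (4 * α) +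
      Real.log (4 / 3) = Real.log 2 + Real.log (32 / 9 * Real.pi) + 2 * Real.log (3 * α) := by
    rw [two_mul (Real.log (3 * α))]
    simp only [← add_assoc]
    have h3 : 0 < 3 * α := by positivity
    have h4 : 0 < 4 * α := by positivity
    have h5 : 0 < 2 * Real.pi * α := by positivity
    rw [← Real.log_mul, ← Real.log_mul, ← Real.log_mul, ← Real.log_mul, ← Real.log_mul,
      ← Real.log_mul, ← Real.log_mul]
    · congr 1; ring
    all_goals positivity
  have hl3 : Real.log (2 * Real.pi * (2 * α)) = Real.log 2 + Real.log (2 * Real.pi * α) := by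
    rw [← Real.log_mul (by norm_num) (by positivity)]
    congr 1; ring
  have hq : 0 ≤ 23 / 10 + 2 * (1 - 1 / (3 * α)) - 6 * α := by
    have : 23 / 10 + 2 * (1 - 1 / (3 * α)) - 6 * α =
      ((23 / 10 + 2) * α - 2 / 3 - 6 * α ^ 2) / α := by field_simp; ring
    rw [this]
    refine div_nonneg ?_ h0.le
    nlinarith
  linarith

theorem stepFun_self_nonneg {a : ℕ} {α α' : ℝ} (hs : Step a α α') {b : ℕ} (hb : b ≤ a) :
    0 ≤ stepFun α b b := by
  have := hs.le_three
  obtain rfl | rfl | rfl | rfl : b = 0 ∨ b = 1 ∨ b = 2 ∨ b = 3 := by omega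
  · simp [stepFun, rowLimit_zero]
  · simpa using stepFun_one_nonneg hs
  · simpa using stepFun_two_nonneg hs hb
  · simpa using stepFun_three_nonneg hs hb

theorem stepFun_inv_nonneg {a : ℕ} {α α' : ℝ} (hs : Step a α α') :
    0 ≤ stepFun α a (1 / α) := by
  have h0 := hs.pos
  have hinv := hs.inv_eq
  have hl' := hs.lower'
  have hu' := hs.upper'
  have hg := logGamma_nonpos (x := 1 + α') (by linarith) (by linarith)
  have hsum := logGamma_sub_eq_sum (z := 1 / α) (b := a) (by rw [hinv]; linarith)
  rw [show 1 + 1 / α - (a : ℝ) = 1 + α' by rw [hinv]; ring, add_comm 1 (1 / α)] at hsum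
  have h2 : 2 ≤ Real.log (2 * Real.pi / α) := by
    have := div_le_log (y := 2 * Real.pi / α) (p := 2) (q := 1) (by positivity) (by norm_num) (by
      rw [pow_one, le_div_iff₀ h0]
      nlinarith [Real.pi_gt_d4, hs.upper])
    simpa using this
  unfold stepFun
  rw [rowLimit_inv h0 hs.lt_one]
  have : 1 / α * (Real.log (2 * Real.pi * α) - 2 * α) =
    1 / α * Real.log (2 * Real.pi * α) - 2 := by field_simp
  rw [this]
  linarith

theorem stepFun_nonneg {a : ℕ} {α α' : ℝ} (hs : Step a α α') {b : ℕ} {z : ℝ} (hb : b ≤ a)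
    (hz : (b : ℝ) ≤ z) (hz1 : z ≤ b + 1) (hz2 : z ≤ 1 / α) : 0 ≤ stepFun α b z := by
  have h := stepFun_self_nonneg hs hb
  rcases hb.lt_or_eq with hlt | rfl
  · refine stepFun_nonneg_of_endpoints hs.pos hs.lt_one (u := ((b + 1 : ℕ) : ℝ)) hz
      (by push_cast; exact hz1) ?_ h ?_
    · rw [hs.inv_eq]
      have : ((b + 1 : ℕ) : ℝ) ≤ a := by exact_mod_cast hlt
      linarith [hs.lower']
    · rw [← stepFun_succ_self]; exact stepFun_self_nonneg hs hlt
  · exact stepFun_nonneg_of_endpoints hs.pos hs.lt_one hz hz2 le_rfl h (stepFun_inv_nonneg hs)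

/-- Weight whose increments are controlled by `logFactor`. -/
noncomputable def weight (x : ℝ) : ℝ := logGamma (1 - x) - 2 * max x 0

theorem log_add_two_mul_nonneg {u : ℝ} (hl : 5 / 19 ≤ u) (hu : u ≤ 1) :
    0 ≤ Real.log u + 2 * (1 - u) := by
  have h0 : 0 < u := by linarith
  rcases le_total u (1 / 2) with h | h
  · have ht := log_add_one_sub_div_le (c := 1 / 4) (y := u) (by norm_num) h0
    have h4 : Real.log (1 / 4) = -(2 * Real.log 2) := by
      rw [one_div, Real.log_inv, show (4 : ℝ) = 2 ^ 2 by norm_num, Real.log_pow]; push_cast; ring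
    have := Real.log_two_lt_d9
    have hq : 0 ≤ 3 - 1.4 - 1 / 4 / u - 2 * u := by
      have : 3 - 1.4 - 1 / 4 / u - 2 * u = (1.6 * u - 1 / 4 - 2 * u ^ 2) / u := by
        field_simp; ring
      rw [this]
      refine div_nonneg ?_ h0.le
      nlinarith
    linarith
  · have ht := log_add_one_sub_div_le (c := 1) (y := u) (by norm_num) h0
    rw [Real.log_one] at ht
    have hq : 0 ≤ 3 - 1 / u - 2 * u := by
      have : 3 - 1 / u - 2 * u = (3 * u - 1 - 2 * u ^ 2) / u := by field_simp
      rw [this]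
      refine div_nonneg ?_ h0.le
      nlinarith
    linarith

theorem log_two_pi_mul_le {α : ℝ} (h0 : 0 < α) (hu : α ≤ 19 / 24) :
    Real.log (2 * Real.pi * α) + 8 / 3 * (gapConst * (2 - α)) ≤ 2 := by
  have hpi := Real.pi_lt_d4
  have hc := gapConst_le
  have hn : Real.log (19 / 12 * Real.pi) ≤ ((45 : ℕ) / (28 : ℕ) : ℝ) := by
    refine log_le_div (by positivity) (by norm_num) ?_
    refine (pow_le_pow_left₀ (by positivity)
      (show 19 / 12 * Real.pi ≤ 19 / 12 * 3.1416 by linarith) 28).trans ?_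
    norm_num
  push_cast at hn
  have ht := Real.log_le_sub_one_of_pos (show 0 < 24 / 19 * α by positivity)
  have e : Real.log (2 * Real.pi * α) = Real.log (19 / 12 * Real.pi) + Real.log (24 / 19 * α) := by
    rw [← Real.log_mul (by positivity) (by positivity)]
    congr 1; ring
  have : gapConst * (2 - α) ≤ 4 / 33 * (2 - α) := by gcongr; linarith
  linarith

theorem rowLimit_le_mul {α t : ℝ} (h0 : 0 < α) (hu : α ≤ 19 / 24) (ht0 : 0 ≤ t)
    (ht1 : t ≤ 1) : rowLimit α t ≤ t * (2 - Real.log (2 * Real.pi * α)) := by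
  have h1 : α < 1 := by linarith
  have h := (tame_rowLimit h0 h1).le_chord t ht0 ht1
  rw [rowLimit_half h0 h1, rowLimit_one h0 h1] at h
  have g1 := logGamma_nonpos (x := 1 + α) (by linarith) (by linarith)
  have g2 := le_logGamma_one_add_half h0.le h1.le
  have g3 := log_two_pi_mul_le h0 hu
  nlinarith

/-- The step inequality: the weight never increases faster than `logFactor` allows. -/
theorem weight_le {a : ℕ} {α α' : ℝ} (hs : Step a α α') {b : ℕ} {z : ℝ} (hl : -1 < z)
    (hu : z < 1 / α)
    (hb : (b = 0 ∧ z < α') ∨ (1 ≤ b ∧ b ≤ a ∧ -α' ≤ b - z ∧ b - z ≤ 1 - α')) :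
    weight (b - z) ≤ logFactor α z + weight (α * z) := by
  have h0 := hs.pos
  have hl' := hs.lower'
  have hu' := hs.upper'
  have hbz : (b : ℝ) - 1 < z := by
    rcases hb with ⟨rfl, _⟩ | ⟨_, _, _, h⟩
    · simpa using hl
    · linarith
  have hba : b ≤ a := by rcases hb with ⟨rfl, _⟩ | ⟨_, h, _⟩ <;> omega
  have hbz' : z ≤ b + α' := by
    rcases hb with ⟨rfl, h⟩ | ⟨_, _, h, _⟩
    · push_cast; linarith
    · linarith
  suffices h : 0 ≤ ∑ i ∈ Finset.range b, Real.log (z - i) + z * Real.log (2 * Real.pi * α) +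
      rowLimit α z - 2 * max (α * z) 0 + 2 * max (b - z) 0 by
    have := logGamma_sub_eq_sum hbz
    unfold weight logFactor
    rw [show 1 - (b - z) = 1 + z - b by ring]
    linarith
  rcases lt_or_ge z 0 with hz | hz
  · have hb0 : b = 0 := by
      rcases hb with ⟨h, _⟩ | ⟨h, _, _, h3⟩
      · exact h
      · have : (1 : ℝ) ≤ b := by exact_mod_cast h
        linarith
    subst hb0
    have hα : 1 < 1 / α := by rw [lt_div_iff₀ h0]; linarith [hs.lt_one]
    have h := rowLimit_le_mul (t := -z) h0 hs.upper (by linarith) (by linarith)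
    rw [rowLimit_neg h0 hs.lt_one (by linarith) (by linarith)] at h
    rw [max_eq_right (by nlinarith), max_eq_left (by simp; linarith)]
    simp
    linarith
  · rw [max_eq_left (by positivity)]
    rcases le_total (b : ℝ) z with h | h
    · have := stepFun_nonneg hs hba h (by linarith) hu.le
      rw [max_eq_right (by linarith)]
      unfold stepFun at this
      linarith
    · rw [max_eq_left (by linarith)]
      rcases Nat.eq_zero_or_pos b with rfl | hb1
      · have : z = 0 := by push_cast at h; linarith
        subst this
        simp [rowLimit_zero]
      · obtain ⟨c, rfl⟩ : ∃ c, b = c + 1 := ⟨b - 1, by omega⟩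
        have h1 : ((c + 1 : ℕ) : ℝ) - z ≤ 1 - α' := by
          rcases hb with ⟨h, _⟩ | ⟨_, _, _, h⟩
          · omega
          · exact h
        push_cast at h hbz hbz' h1 ⊢
        have h2 := stepFun_nonneg hs (b := c) (z := z) (by omega) (by linarith) h hu.le
        have h3 := log_add_two_mul_nonneg (u := z - c) (by linarith) (by linarith)
        unfold stepFun at h2
        rw [Finset.sum_range_succ]
        linarith

/-- Shifted product together with the weight of its endpoint. -/
noncomputable def potential (α θ : ℝ) (n m : ℕ) : ℝ :=
  logShift α θ n + weight (n * α + θ - m)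

theorem exists_next_digit {a : ℕ} {α α' : ℝ} (hs : Step a α α') {z : ℝ} (hl : -1 < z)
    (hu : z < 1 / α) :
    ∃ b : ℕ, -α' < b - z ∧ (b : ℝ) - z < 1 ∧
      ((b = 0 ∧ z < α') ∨ (1 ≤ b ∧ b ≤ a ∧ -α' ≤ b - z ∧ b - z ≤ 1 - α')) := by
  have hl' := hs.lower'
  rcases lt_or_ge z α' with h | h
  · exact ⟨0, by push_cast; linarith, by push_cast; linarith, Or.inl ⟨rfl, h⟩⟩
  · have h1 := Nat.floor_le (show 0 ≤ z - α' by linarith)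
    have h2 := Nat.lt_floor_add_one (z - α')
    have h3 : ⌊z - α'⌋₊ < a := by
      rw [Nat.floor_lt (by linarith)]
      rw [hs.inv_eq] at hu
      linarith
    refine ⟨⌊z - α'⌋₊ + 1, ?_, ?_, Or.inr ⟨by omega, by omega, ?_, ?_⟩⟩ <;> push_cast <;> linarith

/-- One step of the descent along the Gauss map. -/
theorem exists_potential_step {a : ℕ} {α α' θ θ' : ℝ} (hs : Step a α α') (hθ : θ' * α = -θ)
    (hl : -α < θ) (hu : θ < 1) (hl' : -α' < θ') {n m : ℕ} (hxl : -α < n * α + θ - m)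
    (hxu : n * α + θ - m < 1)
    (hne : ∀ i j : ℕ, i ≤ n → (i : ℝ) * α + θ = j → i = 0 ∧ j = 0) :
    ∃ p b : ℕ, n = p + b + m * a ∧ -α' < m * α' + θ' - p ∧ m * α' + θ' - p < 1 ∧
      potential α' θ' m p - logFactor α (θ / α) ≤ potential α θ n m := by
  have h0 := hs.pos
  have hpos' := hs.lower'
  set z := (n * α + θ - m) / α with hz
  have hzl : -1 < z := by rw [hz, lt_div_iff₀ h0]; linarith
  have hzu : z < 1 / α := by rw [hz]; gcongr
  obtain ⟨b, hb1, hb2, hb3⟩ := exists_next_digit hs hzl hzu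
  have hzx : α * z = n * α + θ - m := by rw [hz]; field_simp
  have hze : z = n - θ' - m * (a + α') := by
    have e : α * z = α * (n - θ' - m * (a + α')) := by
      rw [hzx]; linear_combination (m : ℝ) * hs.mul_eq + hθ
    exact mul_left_cancel₀ h0.ne' e
  have hple : b + m * a ≤ n := by
    by_contra hcon
    have hcon' : (n : ℝ) + 1 ≤ b + m * a := by exact_mod_cast not_le.1 hcon
    rcases hb3 with ⟨rfl, _⟩ | ⟨_, _, _, h⟩
    · have hm : 1 ≤ m := by
        rcases Nat.eq_zero_or_pos m with rfl | h
        · omega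
        · exact h
      have hm' : (1 : ℝ) ≤ m := by exact_mod_cast hm
      push_cast at hcon' hb2
      nlinarith
    · have : (0 : ℝ) ≤ m := m.cast_nonneg
      nlinarith
  obtain ⟨p, hp⟩ := Nat.exists_eq_add_of_le hple
  have hp' : (n : ℝ) = b + m * a + p := by exact_mod_cast hp
  have hx' : m * α' + θ' - p = b - z := by rw [hze, hp']; ring
  refine ⟨p, b, by omega, by rw [hx']; exact hb1, by rw [hx']; exact hb2, ?_⟩
  have hw := weight_le hs hzl hzu hb3
  have hsh := logShift_sub_logShift h0 hs.lt_one hs.mul_eq hθ hl hu hxl hxu hne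
  rw [← hz] at hsh
  unfold potential
  rw [hx', ← hzx]
  linarith

theorem logGamma_ge {y : ℝ} (hy : 0 < y) : -1 ≤ logGamma y := by
  have h2 : ∀ y : ℝ, 2 ≤ y → 0 ≤ logGamma y := fun y h => by
    have := le_logGamma_add (x := 1) (s := y - 2) (by norm_num) (by linarith)
    rw [one_add_one_eq_two, logGamma_two, Real.log_one, add_sub_cancel] at this
    linarith
  have h1 : ∀ y : ℝ, 1 ≤ y → -1 ≤ logGamma y := fun y h => by
    rcases le_total 2 y with h' | h'
    · linarith [h2 y h']
    · have := logGamma_add_one (x := y) (by linarith)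
      have := h2 (y + 1) (by linarith)
      have := Real.log_le_sub_one_of_pos (show 0 < y by linarith)
      linarith
  rcases le_total 1 y with h | h
  · exact h1 y h
  · have := logGamma_add_one hy
    have := h1 (y + 1) (by linarith)
    have := Real.log_nonpos hy.le h
    linarith

theorem weight_ge {x : ℝ} (hx : x < 1) : -3 ≤ weight x := by
  have := logGamma_ge (y := 1 - x) (by linarith)
  have : max x 0 ≤ 1 := max_le hx.le zero_le_one
  unfold weight
  linarith

/-- Upper bound for `logGamma` on `[c, 2]`. -/
theorem logGamma_le_of_mem {c y : ℝ} (hc : 0 < c) (hy : c ≤ y) (hy2 : y ≤ 2) :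
    logGamma y ≤ |logGamma c| := by
  have := convexOn_logGamma.le_max_of_mem_Icc (x := c) (y := 2) (z := y) hc
    (by simp) ⟨hy, hy2⟩
  rw [logGamma_two] at this
  exact this.trans (max_le (le_abs_self _) (abs_nonneg _))

theorem weight_le_of_mem {c x : ℝ} (hc : 0 < c) (hx : x ≤ 1 - c) (hx1 : -1 ≤ x) :
    weight x ≤ |logGamma c| := by
  have := logGamma_le_of_mem hc (y := 1 - x) (by linarith) (by linarith)
  have : 0 ≤ max x 0 := le_max_right _ _
  unfold weight
  linarith

theorem exists_nat_sub_mem {α y : ℝ} (hy : -α < y) :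
    ∃ m : ℕ, -α < y - m ∧ y - m ≤ 1 - α := by
  refine ⟨⌈y - (1 - α)⌉₊, ?_, by linarith [Nat.le_ceil (y - (1 - α))]⟩
  rcases le_total 0 (y - (1 - α)) with h | h
  · linarith [Nat.ceil_lt_add_one h]
  · rw [Nat.ceil_eq_zero.2 h]; simpa using hy

theorem mul_eq_nat_iff {α : ℝ} (h : Irrational α) {i j : ℕ} (he : (i : ℝ) * α = j) :
    i = 0 ∧ j = 0 := by
  rcases Nat.eq_zero_or_pos i with rfl | hi
  · simp at he; exact ⟨rfl, by exact_mod_cast he.symm⟩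
  · exact absurd he ((h.natCast_mul hi.ne').ne_nat j)

section Sequence

variable {a : ℕ → ℕ} {α : ℕ → ℝ} (hs : ∀ k, Step (a k) (α k) (α (k + 1)))
  (hirr : ∀ k, Irrational (α k))
include hs hirr

theorem potential_nonneg (k n m : ℕ) (hl : -α k < n * α k + 0 - m) (hu : n * α k + 0 - m < 1) :
    0 ≤ potential (α k) 0 n m := by
  induction hk : n + m using Nat.strong_induction_on generalizing k n m with
  | _ s ih =>
    have h0 := (hs k).pos
    have h0' := (hs (k + 1)).pos
    have h1' := (hs (k + 1)).lt_one
    rcases Nat.eq_zero_or_pos (n + m) with h | h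
    · obtain ⟨rfl, rfl⟩ : n = 0 ∧ m = 0 := by omega
      simp [potential, weight]
    · obtain ⟨p, b, hn, h1, h2, h3⟩ := exists_potential_step (hs k) (θ := 0) (θ' := 0) (by simp)
        (by linarith) one_pos (by linarith) hl hu fun i j _ he =>
          mul_eq_nat_iff (hirr k) (by simpa using he)
      rw [zero_div, logFactor_zero, sub_zero] at h3
      refine (ih (m + p) ?_ (k + 1) m p h1 h2 rfl).trans h3
      rcases Nat.eq_zero_or_pos m with rfl | hm
      · have hp : p = 0 := by
          by_contra hp
          have : (1 : ℝ) ≤ p := by exact_mod_cast Nat.one_le_iff_ne_zero.2 hp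
          simp at h1
          linarith
        omega
      · have := (hs k).one_le
        have : 1 ≤ m * a k := Nat.mul_pos hm this
        omega

theorem logShift_ge (N : ℕ) : -|logGamma (5 / 19)| ≤ logShift (α 0) 0 N := by
  have h0 := (hs 0).pos
  have h1 := (hs 0).lt_one
  have hl := (hs 0).lower
  have : 0 ≤ N * α 0 := by positivity
  obtain ⟨m, hm1, hm2⟩ := exists_nat_sub_mem (α := α 0) (y := N * α 0 + 0) (by linarith)
  have h := potential_nonneg hs hirr 0 N m hm1 (by linarith)
  have hw := weight_le_of_mem (c := 5 / 19) (x := N * α 0 + 0 - m) (by norm_num) (by linarith)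
    (by linarith)
  unfold potential at h
  linarith

end Sequence

/-- Denominators of the reversed expansion truncated after `L` digits, ending with `[…, 1]`. -/
def truncDen (a : ℕ → ℕ) : ℕ → ℕ → ℕ
  | _, 0 => 1
  | k, 1 => a k + 1
  | k, L + 2 => a k * truncDen a (k + 1) (L + 1) + truncDen a (k + 2) L

/-- The shifts `θ_k` attached to `truncDen`. -/
noncomputable def truncShift (α : ℕ → ℝ) : ℕ → ℕ → ℝ
  | k, 0 => 1 - α k
  | k, L + 1 => -(α k * truncShift α (k + 1) L)

/-- The product `∏ 1 / α_j` over `L` consecutive indices. -/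
noncomputable def truncWeight (α : ℕ → ℝ) (k L : ℕ) : ℝ :=
  ∏ j ∈ Finset.range L, (α (k + j))⁻¹

theorem truncWeight_succ (α : ℕ → ℝ) (k L : ℕ) :
    truncWeight α k (L + 1) = (α k)⁻¹ * truncWeight α (k + 1) L := by
  unfold truncWeight
  rw [Finset.prod_range_succ', mul_comm]
  congr 1
  exact Finset.prod_congr rfl fun j _ => by rw [show k + (j + 1) = k + 1 + j by ring]

section Sequence

variable {a : ℕ → ℕ} {α : ℕ → ℝ} (hs : ∀ k, Step (a k) (α k) (α (k + 1)))
include hs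

theorem truncDen_mul (L k : ℕ) :
    (truncDen a k (L + 1) : ℝ) * α k = truncDen a (k + 1) L - truncShift α k (L + 1) := by
  have h := (hs k).mul_eq
  induction L generalizing k with
  | zero =>
    simp only [truncDen, truncShift]
    push_cast
    linear_combination h
  | succ L ih =>
    have h2 := ih (k + 1) (hs (k + 1)).mul_eq
    rw [truncShift]
    conv_lhs => rw [truncDen]
    push_cast
    linear_combination (truncDen a (k + 1) (L + 1) : ℝ) * h - α k * h2

theorem truncShift_abs_pos (L k : ℕ) : 0 < |truncShift α k L| ∧ |truncShift α k L| < 1 := by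
  induction L generalizing k with
  | zero =>
    have h0 := (hs k).pos
    have h1 := (hs k).lt_one
    rw [truncShift, abs_of_pos (by linarith)]
    constructor <;> linarith
  | succ L ih =>
    have h0 := (hs k).pos
    have h1 := (hs k).lt_one
    obtain ⟨h2, h3⟩ := ih (k + 1)
    rw [truncShift, abs_neg, abs_mul, abs_of_pos h0]
    exact ⟨by positivity, by nlinarith⟩

theorem truncShift_succ_abs_lt (L k : ℕ) : |truncShift α k (L + 1)| < α k := by
  have h0 := (hs k).pos
  obtain ⟨h2, h3⟩ := truncShift_abs_pos hs L (k + 1)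
  rw [truncShift, abs_neg, abs_mul, abs_of_pos h0]
  nlinarith

theorem neg_lt_truncShift (L k : ℕ) : -α k < truncShift α k L := by
  rcases L with _ | L
  · rw [truncShift]; linarith
  · exact (abs_lt.1 (truncShift_succ_abs_lt hs L k)).1

theorem truncWeight_pos (k L : ℕ) : 0 < truncWeight α k L :=
  Finset.prod_pos fun _ _ => inv_pos.2 (hs _).pos

theorem truncWeight_le_truncDen (k L : ℕ) : truncWeight α k L ≤ truncDen a k L := by
  have hinv : ∀ k, (α k)⁻¹ = a k + α (k + 1) := fun k => by rw [← one_div, (hs k).inv_eq]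
  induction L using Nat.strong_induction_on generalizing k with
  | _ L ih =>
    match L, ih with
    | 0, _ => simp [truncWeight, truncDen]
    | 1, _ =>
      have := (hs (k + 1)).lt_one
      simp [truncWeight, truncDen, hinv]
      linarith
    | L + 2, ih =>
      have h1 := ih (L + 1) (by omega) (k + 1)
      have h2 := ih L (by omega) (k + 2)
      have e : truncWeight α k (L + 2) =
          a k * truncWeight α (k + 1) (L + 1) + truncWeight α (k + 2) L := by
        have h3 := truncWeight_succ α (k + 1) L
        have h4 : α (k + 1) * (α (k + 1))⁻¹ = 1 := mul_inv_cancel₀ (hs (k + 1)).pos.ne'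
        rw [truncWeight_succ, hinv]
        linear_combination α (k + 1) * h3 + truncWeight α (k + 1 + 1) L * h4
      rw [e, truncDen]
      push_cast
      gcongr

theorem logFactor_truncShift_add (L k : ℕ) :
    logFactor (α k) (truncShift α k (L + 1) / α k) +
      logFactor (α k) (-truncShift α k (L + 1) / α k) =
    logChord (truncShift α k (L + 1)) - logChord (truncShift α (k + 1) L) - Real.log (α k) := by
  have h0 := (hs k).pos
  obtain ⟨h2, h3⟩ := truncShift_abs_pos hs L (k + 1)
  have e : truncShift α k (L + 1) / α k = -truncShift α (k + 1) L := by
    rw [truncShift]; field_simp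
  rw [neg_div, logFactor_add_neg h0 (hs k).lt_one, mul_div_cancel₀ _ h0.ne', e, logChord_neg]
  · rw [e]; exact neg_ne_zero.2 (abs_pos.1 h2)
  · rw [e, abs_neg]; exact h3

variable (hirr : ∀ k, Irrational (α k))
include hirr

theorem logShift_truncDen (L k : ℕ) :
    logShift (α k) 0 (truncDen a k (L + 1)) =
      logFactor (α k) (-truncShift α k (L + 1) / α k) +
        logShift (α (k + 1)) 0 (truncDen a (k + 1) L) := by
  have h := abs_lt.1 (truncShift_succ_abs_lt hs L k)
  have hm := truncDen_mul hs L k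
  have h1 := (hs k).lt_one
  have h0 := (hs k).pos
  have he : (truncDen a k (L + 1) : ℝ) * α k + 0 - truncDen a (k + 1) L =
    -truncShift α k (L + 1) := by linarith
  have := logShift_sub_logShift (θ := 0) (θ' := 0) (N := truncDen a k (L + 1))
    (M := truncDen a (k + 1) L) h0 h1 (hs k).mul_eq (by simp)
    (by linarith) one_pos (by rw [he]; linarith) (by rw [he]; linarith) fun i j _ hij =>
      mul_eq_nat_iff (hirr k) (by simpa using hij)
  rw [he, zero_div, logFactor_zero] at this
  linarith

theorem potential_trunc_ge (L k n m : ℕ) (hn : n < truncDen a k L)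
    (hl : -α k < n * α k + truncShift α k L - m) (hu : n * α k + truncShift α k L - m < 1) :
    logShift (α k) 0 (truncDen a k L) - logChord (truncShift α k L)
      - Real.log (truncWeight α k L) - 3 ≤ potential (α k) (truncShift α k L) n m := by
  induction L generalizing k n m with
  | zero =>
    obtain rfl : n = 0 := by simpa [truncDen] using hn
    have hc : logChord (1 - α k) = logChord (α k) := by
      rw [← logChord_neg (α k), ← logChord_add_int _ (-1 : ℤ)]
      congr 1; push_cast; ring
    have := weight_ge hu
    simp only [truncDen, truncShift, truncWeight, potential, logShift] at this ⊢
    simp [hc] at this ⊢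
    linarith
  | succ L ih =>
    have h0 := (hs k).pos
    have h1 := (hs k).lt_one
    have hm := truncDen_mul hs L k
    have hθ := abs_lt.1 (truncShift_succ_abs_lt hs L k)
    obtain ⟨p, b, hnp, h1', h2', h3'⟩ := exists_potential_step (hs k)
      (θ' := truncShift α (k + 1) L) (by rw [truncShift]; ring) hθ.1 (by linarith)
      (neg_lt_truncShift hs L (k + 1)) hl hu fun i j hi hij => by
        exfalso
        obtain ⟨d, hd⟩ := Nat.exists_eq_add_of_lt (lt_of_le_of_lt hi hn)
        rw [hd] at hm
        push_cast at hm
        have hd1 : ((d + 1 : ℕ) : ℝ) * α k = ((truncDen a (k + 1) L : ℤ) - (j : ℤ) : ℤ) := by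
          push_cast; linarith
        exact ((hirr k).natCast_mul (Nat.succ_ne_zero d)).ne_int _ hd1
    have hnQ : m < truncDen a (k + 1) L := by
      have hn' : (n : ℝ) + 1 ≤ truncDen a k (L + 1) := by exact_mod_cast hn
      have : (m : ℝ) < truncDen a (k + 1) L := by nlinarith
      exact_mod_cast this
    have hI := ih (k + 1) m p hnQ h1' h2'
    have hQ := logShift_truncDen hs hirr L k
    have hF := logFactor_truncShift_add hs L k
    have hW : Real.log (truncWeight α k (L + 1)) =
        Real.log (truncWeight α (k + 1) L) - Real.log (α k) := by
      rw [truncWeight_succ, Real.log_mul (inv_pos.2 h0).ne' (truncWeight_pos hs _ _).ne',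
        Real.log_inv]
      ring
    linarith

omit hirr hs in
theorem logShift_reflect {α θ : ℝ} {Q q N n : ℕ} (hQ : Q = N + n + 1) (hθ : θ = q - Q * α) :
    logShift α 0 N + logShift α θ n = logShift α 0 Q - logChord θ := by
  have h1 : logChord θ = logChord ((((N + n : ℕ) : ℝ) + 1) * α + 0) := by
    rw [← logChord_neg, ← logChord_add_int _ (q : ℤ), hθ, hQ]
    congr 1; push_cast; ring
  rw [hQ, logShift_succ, h1, add_sub_cancel_right]
  unfold logShift
  rw [Finset.sum_range_add]
  congr 1
  rw [← Finset.sum_range_reflect]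
  refine Finset.sum_congr rfl fun r hr => ?_
  have hr := Finset.mem_range.1 hr
  rw [← logChord_neg, ← logChord_add_int _ (q : ℤ), hθ, hQ]
  have : ((n - 1 - r : ℕ) : ℝ) = n - 1 - r := by
    rw [Nat.cast_sub (by omega), Nat.cast_sub (by omega)]; simp
  congr 1
  push_cast
  rw [this]
  ring

theorem logShift_le_of_lt {N L : ℕ} (hN : N < truncDen a 0 (L + 1)) :
    logShift (α 0) 0 N ≤ Real.log (truncWeight α 0 (L + 1)) + 3 + |logGamma (5 / 19)| := by
  obtain ⟨n, hn⟩ := Nat.exists_eq_add_of_lt hN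
  have hm := truncDen_mul hs L 0
  have hr := logShift_reflect (α := α 0) (θ := truncShift α 0 (L + 1)) hn
    (q := truncDen a (0 + 1) L) (by linarith)
  have h0 := (hs 0).pos
  have h1 := (hs 0).lt_one
  have hl := (hs 0).lower
  have hθ := neg_lt_truncShift hs (L + 1) 0
  have : 0 ≤ n * α 0 := by positivity
  obtain ⟨m, hm1, hm2⟩ := exists_nat_sub_mem (α := α 0) (y := n * α 0 + truncShift α 0 (L + 1))
    (by linarith)
  have h := potential_trunc_ge hs hirr (L + 1) 0 n m (by omega) hm1 (by linarith)
  have hw := weight_le_of_mem (c := 5 / 19) (x := n * α 0 + truncShift α 0 (L + 1) - m)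
    (by norm_num) (by linarith) (by linarith)
  unfold potential at h
  linarith

omit hirr in
theorem exists_lt_truncDen (N : ℕ) : ∃ L, N < truncDen a 0 L := by
  obtain ⟨L, hL⟩ := pow_unbounded_of_one_lt (N : ℝ) (show (1 : ℝ) < 24 / 19 by norm_num)
  refine ⟨L, ?_⟩
  have : (24 / 19 : ℝ) ^ L ≤ truncWeight α 0 L := by
    unfold truncWeight
    rw [← Finset.card_range L, ← Finset.prod_const, Finset.card_range]
    refine Finset.prod_le_prod (fun _ _ => by norm_num) fun j _ => ?_
    rw [le_inv_comm₀ (by norm_num) (hs _).pos]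
    exact (hs _).upper.trans (by norm_num)
  exact_mod_cast hL.trans_le (this.trans (truncWeight_le_truncDen hs 0 L))

theorem logShift_le (N : ℕ) :
    logShift (α 0) 0 N ≤ 5 + |logGamma (5 / 19)| + Real.log (N + 1) := by
  classical
  have hex := exists_lt_truncDen hs N
  rcases hK : Nat.find hex with _ | L
  · have h := Nat.find_spec hex
    rw [hK] at h
    obtain rfl : N = 0 := by simpa [truncDen] using h
    simp
    positivity
  · have h := Nat.find_spec hex
    have hmin := Nat.find_min hex (m := L) (by omega)
    rw [hK] at h
    have hb := logShift_le_of_lt hs hirr h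
    have hW : truncWeight α 0 (L + 1) ≤ 19 / 5 * (N + 1) := by
      have h1 : truncWeight α 0 L ≤ N + 1 := by
        have : (truncDen a 0 L : ℝ) ≤ N := by exact_mod_cast not_lt.1 hmin
        linarith [truncWeight_le_truncDen hs 0 L]
      have h2 : (α (0 + L))⁻¹ ≤ 19 / 5 := by
        rw [inv_le_comm₀ (hs _).pos (by norm_num)]
        exact le_trans (by norm_num) (hs _).lower
      unfold truncWeight at h1 ⊢
      rw [Finset.prod_range_succ, mul_comm]
      gcongr
      exact Finset.prod_nonneg fun j _ => (inv_pos.2 (hs _).pos).le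
    have h3 := Real.log_le_log (truncWeight_pos hs 0 (L + 1)) hW
    rw [Real.log_mul (by norm_num) (by positivity)] at h3
    have h4 : Real.log (19 / 5) ≤ ((2 : ℕ) / (1 : ℕ) : ℝ) :=
      log_le_div (by norm_num) (by norm_num) (by norm_num)
    push_cast at h4
    linarith

end Sequence

theorem exists_abs_rowLimit_le {α : ℝ} (h0 : 0 < α) (h1 : α < 1) :
    ∃ C, ∀ z, -1 ≤ z → z ≤ 1 / α → |rowLimit α z| ≤ C := by
  have ht := tame_rowLimit h0 h1
  have hα : 1 < 1 / α := by rw [lt_div_iff₀ h0]; linarith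
  have hzero := rowLimit_zero (α := α)
  set U := rowLimit α
  set C := |U (1 / α)| + |8 * U (1 / 2) - U 1| + 1 / α * |U 1|
  have hC1 : 0 ≤ 1 / α * |U 1| := by positivity
  have hpos : ∀ z, 0 ≤ z → z ≤ 1 / α → |U z| ≤ C := by
    intro z hz hzα
    refine abs_le.2 ⟨?_, ?_⟩
    · have := ht.concave.min_le_of_mem_Icc (x := 0) (y := 1 / α) (z := z) ⟨le_rfl, by linarith⟩
        ⟨by linarith, by linarith⟩ ⟨hz, hzα⟩
      have h2 : -|U (1 / α)| ≤ min (U 0) (U (1 / α)) :=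
        le_min (by rw [hzero]; linarith [abs_nonneg (U (1 / α))]) (neg_abs_le _)
      linarith [abs_nonneg (8 * U (1 / 2) - U 1)]
    · rcases le_total z 1 with hz1 | hz1
      · have h2 := ht.le_chord z hz hz1
        have h4 : z * (8 * U (1 / 2) - U 1) ≤ |8 * U (1 / 2) - U 1| := by
          nlinarith [le_abs_self (8 * U (1 / 2) - U 1), abs_nonneg (8 * U (1 / 2) - U 1)]
        linarith [abs_nonneg (8 * U (1 / 2) - U 1), abs_nonneg (U (1 / α))]
      · have hz0 : 0 < z := by linarith
        have h2 := ht.concave.2 ⟨hz, by linarith⟩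
          (⟨le_rfl, by linarith⟩ : (0 : ℝ) ∈ Ico 0 (1 / α + 1))
          (by positivity : 0 ≤ 1 / z)
          (by rw [sub_nonneg, div_le_one hz0]; exact hz1 : 0 ≤ 1 - 1 / z) (by ring)
        simp only [smul_eq_mul, hzero, mul_zero, add_zero, one_div_mul_cancel hz0.ne'] at h2
        have h3 : U z ≤ z * U 1 := by
          rw [one_div, inv_mul_le_iff₀ hz0] at h2; exact h2
        have h4 : z * U 1 ≤ 1 / α * |U 1| := by
          nlinarith [le_abs_self (U 1), abs_nonneg (U 1)]
        linarith [abs_nonneg (8 * U (1 / 2) - U 1), abs_nonneg (U (1 / α))]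
  refine ⟨C, fun z hz hzα => ?_⟩
  rcases le_total 0 z with h | h
  · exact hpos z h hzα
  · have h2 := rowLimit_neg h0 h1 (z := -z) (by linarith) (by linarith)
    rw [neg_neg] at h2
    change |rowLimit α z| ≤ C
    rw [h2, abs_neg]
    exact hpos (-z) (by linarith) (by linarith)

theorem exists_logFactor_bounds {α : ℝ} (h0 : 0 < α) (h1 : α < 1) :
    ∃ C, (∀ z, -1 < z → α * z ≤ 1 - α → -C ≤ logFactor α z) ∧
      ∀ z, -1 / 2 ≤ z → α * z < 1 → logFactor α z ≤ C := by
  obtain ⟨C, hC⟩ := exists_abs_rowLimit_le h0 h1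
  have hα : 1 < 1 / α := by rw [lt_div_iff₀ h0]; linarith
  set l := Real.log (2 * Real.pi * α)
  have hl : ∀ z, -1 ≤ z → z ≤ 1 / α → |z * l| ≤ 1 / α * |l| := fun z hz hzα => by
    rw [abs_mul]
    exact mul_le_mul_of_nonneg_right (abs_le.2 ⟨by linarith, hzα⟩) (abs_nonneg _)
  have hle : ∀ z, α * z < 1 → z ≤ 1 / α := fun z hz => by
    rw [le_div_iff₀ h0]; linarith
  have hm1 := abs_nonneg (logGamma α)
  have hm2 := abs_nonneg (logGamma (1 / 2))
  have hm3 := abs_nonneg (logGamma (1 + 1 / α))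
  refine ⟨1 / α * |l| + 1 + |logGamma α| + |logGamma (1 / 2)| + |logGamma (1 + 1 / α)| + C,
    fun z hz hzα => ?_, fun z hz hzα => ?_⟩
  · have hz2 := hle z (by linarith)
    have h2 := abs_le.1 (hC z hz.le hz2)
    have h3 := abs_le.1 (hl z hz.le hz2)
    have h4 := logGamma_ge (y := 1 + z) (by linarith)
    have h5 := logGamma_le_of_mem h0 (y := 1 - α * z) (by linarith) (by nlinarith)
    unfold logFactor
    linarith
  · have hz2 := hle z hzα
    have h2 := abs_le.1 (hC z (by linarith) hz2)
    have h3 := abs_le.1 (hl z (by linarith) hz2)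
    have h4 := logGamma_ge (y := 1 - α * z) (by linarith)
    have h5 := convexOn_logGamma.le_max_of_mem_Icc (x := 1 / 2) (y := 1 + 1 / α) (z := 1 + z)
      (by norm_num) (by simp only [mem_Ioi]; linarith) ⟨by linarith, by linarith⟩
    have h6 : max (logGamma (1 / 2)) (logGamma (1 + 1 / α)) ≤
        |logGamma (1 / 2)| + |logGamma (1 + 1 / α)| :=
      max_le (by linarith [le_abs_self (logGamma (1 / 2))])
        (by linarith [le_abs_self (logGamma (1 + 1 / α))])
    unfold logFactor
    linarith

/-- `log P_N(α)` is bounded below, and bounded above by `log N` up to a constant. -/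
def SudlerBounded (α : ℝ) : Prop :=
  ∃ C, ∀ N : ℕ, -C ≤ logShift α 0 N ∧ logShift α 0 N ≤ C + Real.log (N + 1)

theorem SudlerBounded.of_mul_eq {α α' : ℝ} {a : ℕ} (hirr : Irrational α) (h0 : 0 < α)
    (h1 : α < 1) (hα : α * (a + α') = 1) (h : SudlerBounded α') : SudlerBounded α := by
  obtain ⟨C, hC⟩ := h
  obtain ⟨D, hD1, hD2⟩ := exists_logFactor_bounds h0 h1
  have key : ∀ N M : ℕ, -α < N * α - M → N * α - M < 1 →
      logShift α 0 N = logShift α' 0 M + logFactor α ((N * α - M) / α) := by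
    intro N M hl hu
    have := logShift_sub_logShift (θ := 0) (θ' := 0) (N := N) (M := M) h0 h1 hα (by simp)
      (by linarith) one_pos (by linarith) (by linarith) fun i j _ hij =>
        mul_eq_nat_iff hirr (by simpa using hij)
    rw [zero_div, logFactor_zero, add_zero] at this
    linarith
  refine ⟨C + D, fun N => ?_⟩
  have hN : 0 ≤ N * α := by positivity
  constructor
  · obtain ⟨M, hM1, hM2⟩ := exists_nat_sub_mem (α := α) (y := N * α) (by linarith)
    have h2 := hD1 ((N * α - M) / α) (by rw [lt_div_iff₀ h0]; linarith)
      (by rw [mul_div_cancel₀ _ h0.ne']; exact hM2)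
    linarith [key N M hM1 (by linarith), (hC M).1]
  · set M := ⌊N * α + α / 2⌋₊
    have hM1 : (M : ℝ) ≤ N * α + α / 2 := Nat.floor_le (by positivity)
    have hM2 : N * α + α / 2 < M + 1 := Nat.lt_floor_add_one _
    have hMN : (M : ℝ) ≤ N := by
      have : (M : ℝ) < N + 1 := by nlinarith [(Nat.cast_nonneg N : (0 : ℝ) ≤ N)]
      exact_mod_cast Nat.lt_succ_iff.1 (by exact_mod_cast this)
    have h2 := hD2 ((N * α - M) / α) (by rw [le_div_iff₀ h0]; linarith)
      (by rw [mul_div_cancel₀ _ h0.ne']; linarith)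
    have h3 : Real.log (M + 1) ≤ Real.log (N + 1) := Real.log_le_log (by positivity) (by linarith)
    linarith [key N M (by linarith) (by linarith), (hC M).2]

theorem gaussMap_mem {α : ℝ} (hirr : Irrational α) :
    0 < gaussMap α ∧ gaussMap α < 1 ∧ Irrational (gaussMap α) := by
  have h : Irrational (gaussMap α) := by
    have : gaussMap α = α⁻¹ - (⌊α⁻¹⌋ : ℤ) := (Int.self_sub_floor _).symm
    rw [this]
    exact hirr.inv.sub_intCast _
  exact ⟨lt_of_le_of_ne (Int.fract_nonneg _) h.ne_zero.symm, Int.fract_lt_one _, h⟩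

theorem mul_floor_add_gaussMap {α : ℝ} (h0 : 0 < α) :
    α * (⌊α⁻¹⌋₊ + gaussMap α) = 1 := by
  have : (⌊α⁻¹⌋₊ : ℝ) = (⌊α⁻¹⌋ : ℤ) := natCast_floor_eq_intCast_floor (inv_pos.2 h0).le
  rw [gaussMap, this, Int.floor_add_fract, mul_inv_cancel₀ h0.ne']

theorem iterate_gaussMap_mem {α : ℝ} (h0 : 0 < α) (h1 : α < 1) (hirr : Irrational α) (k : ℕ) :
    0 < gaussMap^[k] α ∧ gaussMap^[k] α < 1 ∧ Irrational (gaussMap^[k] α) := by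
  cases k with
  | zero => exact ⟨h0, h1, hirr⟩
  | succ k =>
    rw [Function.iterate_succ_apply']
    refine gaussMap_mem ?_
    induction k with
    | zero => exact hirr
    | succ k ih => rw [Function.iterate_succ_apply']; exact (gaussMap_mem ih).2.2

theorem SudlerBounded.of_iterate {α : ℝ} (h0 : 0 < α) (h1 : α < 1) (hirr : Irrational α) {k : ℕ}
    (h : SudlerBounded (gaussMap^[k] α)) : SudlerBounded α := by
  induction k with
  | zero => exact h
  | succ k ih =>
    obtain ⟨g0, g1, gi⟩ := iterate_gaussMap_mem h0 h1 hirr k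
    rw [Function.iterate_succ_apply'] at h
    exact ih (h.of_mul_eq gi g0 g1 (mul_floor_add_gaussMap g0))

theorem step_of_forall {a : ℕ → ℕ} {α : ℕ → ℝ} (h0 : ∀ k, 0 < α k) (h1 : ∀ k, α k < 1)
    (hmul : ∀ k, α k * (a k + α (k + 1)) = 1) (ha : ∀ k, a k ≤ 3) (k : ℕ) :
    Step (a k) (α k) (α (k + 1)) := by
  have ha1 : ∀ k, 1 ≤ a k := fun k => by
    rw [Nat.one_le_iff_ne_zero]
    intro h
    have := hmul k
    rw [h, Nat.cast_zero, zero_add] at this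
    nlinarith [h0 k, h1 k, h0 (k + 1), h1 (k + 1)]
  have ha1' : ∀ k, (1 : ℝ) ≤ a k := fun k => by exact_mod_cast ha1 k
  have ha3' : ∀ k, (a k : ℝ) ≤ 3 := fun k => by exact_mod_cast ha k
  have l1 : ∀ k, 1 / 4 ≤ α k := fun k => by
    nlinarith [h0 k, h1 (k + 1), ha3' k, hmul k]
  have u1 : ∀ k, α k ≤ 4 / 5 := fun k => by
    nlinarith [h0 k, l1 (k + 1), ha1' k, hmul k]
  have l2 : ∀ k, 5 / 19 ≤ α k := fun k => by
    nlinarith [h0 k, u1 (k + 1), ha3' k, hmul k]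
  have u2 : ∀ k, α k ≤ 19 / 24 := fun k => by
    nlinarith [h0 k, l2 (k + 1), ha1' k, hmul k]
  exact ⟨ha1 k, ha k, hmul k, l2 k, u2 k, l2 _, u2 _⟩

theorem sudlerBounded {α : ℝ} (h0 : 0 < α) (h1 : α < 1) (hirr : Irrational α)
    (ha : ∀ᶠ i in atTop, pq α i ≤ 3) : SudlerBounded α := by
  obtain ⟨k, hk⟩ := eventually_atTop.1 ha
  refine .of_iterate (k := k) h0 h1 hirr ?_
  have hmem := fun j => iterate_gaussMap_mem h0 h1 hirr (k + j)
  have hs := step_of_forall (a := fun j => pq α (k + j + 1)) (α := fun j => gaussMap^[k + j] α)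
    (fun j => (hmem j).1) (fun j => (hmem j).2.1) (fun j => by
      have := mul_floor_add_gaussMap (hmem j).1
      simp only [pq, Nat.add_sub_cancel, ← add_assoc, Function.iterate_succ_apply'] at this ⊢
      exact this) (fun j => hk _ (by omega))
  have hirr' := fun j => (hmem j).2.2
  refine ⟨5 + |logGamma (5 / 19)|, fun N => ⟨?_, logShift_le hs hirr' N⟩⟩
  have := logShift_ge hs hirr' N
  simp only [add_zero] at this
  linarith

theorem sudler_eq_exp {α : ℝ} (hirr : Irrational α) (N : ℕ) :
    sudler α N = Real.exp (logShift α 0 N) := by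
  induction N with
  | zero => simp [sudler]
  | succ N ih =>
    have hsin : 0 < 2 * |Real.sin (Real.pi * (N + 1 : ℕ) * α)| := by
      refine mul_pos two_pos (abs_pos.2 fun h => ?_)
      obtain ⟨n, hn⟩ := Real.sin_eq_zero_iff.1 h
      refine (hirr.natCast_mul N.succ_ne_zero).ne_int n (mul_left_cancel₀ Real.pi_ne_zero ?_)
      rw [mul_comm Real.pi (n : ℝ), hn, mul_assoc]
    rw [sudler, Finset.prod_Icc_succ_top (by omega), ← sudler, ih, logShift_succ, Real.exp_add,
      logChord, add_zero, ← Nat.cast_succ, ← mul_assoc Real.pi, Real.exp_log hsin]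

theorem eventually_pq_le {α : ℝ}
    (ha : limsup (fun i : ℕ => (pq α i : ℕ∞)) atTop ≤ 3) : ∀ᶠ i in atTop, pq α i ≤ 3 := by
  have h : limsup (fun i : ℕ => (pq α i : ℕ∞)) atTop < 4 := ha.trans_lt (by norm_num)
  filter_upwards [eventually_lt_of_limsup_lt h] with i hi
  have : pq α i < 4 := by exact_mod_cast hi
  omega

end Sudler

/-- If `α ∈ (0,1)` is irrational with `limsup aᵢ ≤ 3`, then
`liminf P_N(α) > 0` and `limsup P_N(α)/N < ∞`. -/
theorem sudler_liminf_pos_of_limsup_partial_quotients_le_three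
    (α : ℝ) (h0 : 0 < α) (h1 : α < 1) (hirr : Irrational α)
    (ha : Filter.limsup (fun i : ℕ => (pq α i : ℕ∞)) Filter.atTop ≤ 3) :
    0 < Filter.liminf (fun N : ℕ => (sudler α N : EReal)) Filter.atTop ∧
    Filter.limsup (fun N : ℕ => ((sudler α N / N : ℝ) : EReal)) Filter.atTop < ⊤ := by
  obtain ⟨C, hC⟩ := Sudler.sudlerBounded h0 h1 hirr (Sudler.eventually_pq_le ha)
  constructor
  · refine lt_of_lt_of_le (b := ((Real.exp (-C) : ℝ) : EReal))
      (by exact_mod_cast Real.exp_pos _) (Filter.le_liminf_of_le (by isBoundedDefault)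
        (Filter.Eventually.of_forall fun N => ?_))
    rw [Sudler.sudler_eq_exp hirr]
    exact_mod_cast Real.exp_le_exp.2 (hC N).1
  · refine lt_of_le_of_lt (b := ((2 * Real.exp C : ℝ) : EReal))
      (Filter.limsup_le_of_le (by isBoundedDefault) ?_) (EReal.coe_lt_top _)
    filter_upwards [Filter.eventually_ge_atTop 1] with N hN
    have hN' : (1 : ℝ) ≤ N := by exact_mod_cast hN
    have h := Real.exp_le_exp.2 (hC N).2
    rw [Real.exp_add, Real.exp_log (by positivity)] at h
    rw [Sudler.sudler_eq_exp hirr, EReal.coe_le_coe_iff, div_le_iff₀ (by positivity)]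
    nlinarith [Real.exp_pos C]
end

section
/- Let α ∈ (0,1) be irrational and let N be an integer with q_n ≤ N < q_{n+1} and Ostrowski expansion N = Σ_{ℓ=0}^{n} b_ℓ q_ℓ. Then P_N(α) = ∏_{i=0}^{n} ∏_{t=0}^{b_i − 1} P_{q_i}(α, ε_{i,t}(N)). -/
/-- `qden α k` is the denominator `q_k` of the `k`-th convergent of `α`:
`q₀ = 1`, `q₁ = a₁`, `q_{k+2} = a_{k+2} q_{k+1} + q_k`. -/
noncomputable def qden (α : ℝ) : ℕ → ℕ
  | 0 => 1
  | 1 => pq α 1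
  | (k + 2) => pq α (k + 2) * qden α (k + 1) + qden α k

/-- Distance to the nearest integer. -/
noncomputable def nint (x : ℝ) : ℝ := |x - round x|

/-- `δ_k = ‖q_k α‖`. -/
noncomputable def dlt (α : ℝ) (k : ℕ) : ℝ := nint (qden α k * α)

/-- The perturbed Sudler product
`P_{q_n}(α, ε) = ∏_{r=1}^{q_n} 2|sin(π(rα + (-1)^n ε/q_n))|`. -/
noncomputable def sudlerPert (α : ℝ) (n : ℕ) (ε : ℝ) : ℝ :=
  ∏ r ∈ Finset.Icc 1 (qden α n),
    2 * |Real.sin (Real.pi * (r * α + (-1 : ℝ) ^ n * ε / qden α n))|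

/-- `ε_{i,t}(N) = q_i (t δ_i + Σ_{j=1}^{n-i} (-1)^j b_{i+j} δ_{i+j})`,
where `b` are the Ostrowski digits of `N` with top index `n`. -/
noncomputable def eps (α : ℝ) (b : ℕ → ℕ) (n i t : ℕ) : ℝ :=
  (qden α i : ℝ) *
    (t * dlt α i + ∑ j ∈ Finset.Icc 1 (n - i), (-1 : ℝ) ^ j * b (i + j) * dlt α (i + j))

section Combinatorics

variable {M : Type*} [CommMonoid M]

theorem prod_Icc_one_add (f : ℕ → M) (m k : ℕ) :
    ∏ r ∈ Finset.Icc 1 (m + k), f r =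
      (∏ r ∈ Finset.Icc 1 m, f r) * ∏ r ∈ Finset.Icc 1 k, f (m + r) := by
  induction k with
  | zero => simp
  | succ k ih =>
    rw [← add_assoc, Finset.prod_Icc_succ_top (by omega), ih,
      Finset.prod_Icc_succ_top (by omega), mul_assoc, add_assoc]

theorem prod_Icc_one_mul (f : ℕ → M) (c q : ℕ) :
    ∏ r ∈ Finset.Icc 1 (c * q), f r =
      ∏ t ∈ Finset.range c, ∏ r ∈ Finset.Icc 1 q, f (t * q + r) := by
  induction c with
  | zero => simp
  | succ c ih => rw [Nat.succ_mul, prod_Icc_one_add, ih, Finset.prod_range_succ]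

/-- Splitting `{1, …, ∑ b_i q_i}` into blocks of length `q_i`, those with large `i` first. -/
theorem prod_Icc_one_sum_mul (f : ℕ → M) (b q : ℕ → ℕ) (n : ℕ) :
    ∏ r ∈ Finset.Icc 1 (∑ i ∈ Finset.range n, b i * q i), f r =
      ∏ i ∈ Finset.range n, ∏ t ∈ Finset.range (b i), ∏ r ∈ Finset.Icc 1 (q i),
        f (∑ j ∈ Finset.Ico (i + 1) n, b j * q j + t * q i + r) := by
  induction n generalizing f with
  | zero => simp
  | succ n ih =>
    rw [Finset.sum_range_succ, add_comm, prod_Icc_one_add, prod_Icc_one_mul,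
      ih fun r => f (b n * q n + r), Finset.prod_range_succ, mul_comm]
    congr 1
    · refine Finset.prod_congr rfl fun i hi => Finset.prod_congr rfl fun t _ =>
        Finset.prod_congr rfl fun r _ => congrArg f ?_
      rw [Finset.sum_Ico_succ_top (by have := Finset.mem_range.1 hi; omega)]
      ring
    · simp

end Combinatorics

theorem abs_sin_pi_mul_add_intCast (x : ℝ) (m : ℤ) :
    |Real.sin (Real.pi * (x + m))| = |Real.sin (Real.pi * x)| := by
  rw [mul_add, mul_comm Real.pi (m : ℝ), Real.sin_add_int_mul_pi, abs_mul, abs_zpow]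
  simp

theorem nint_intCast_add (m : ℤ) (x : ℝ) : nint (m + x) = nint x := by
  simp [nint, round_intCast_add]

theorem nint_neg_one_pow_mul {x : ℝ} (hx0 : 0 ≤ x) (hx : x < 1 / 2) (k : ℕ) :
    nint ((-1) ^ k * x) = x := by
  have hr : round ((-1) ^ k * x) = 0 := by
    rw [round_eq_zero_iff]
    rcases neg_one_pow_eq_or ℝ k with h | h <;> rw [h] <;> constructor <;> linarith
  rw [nint, hr]
  simp [abs_mul, abs_of_nonneg hx0]

section GaussMap

variable {α : ℝ}

theorem gaussMap_iterate_mem (h0 : 0 < α) (h1 : α < 1) (hirr : Irrational α) (k : ℕ) :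
    0 < gaussMap^[k] α ∧ gaussMap^[k] α < 1 ∧ Irrational (gaussMap^[k] α) := by
  induction k with
  | zero => exact ⟨h0, h1, hirr⟩
  | succ k ih =>
    rw [Function.iterate_succ_apply']
    have hi : Irrational (gaussMap (gaussMap^[k] α)) := by
      rw [gaussMap, Int.fract]
      exact ih.2.2.inv.sub_intCast _
    exact ⟨(Int.fract_nonneg _).lt_of_ne' hi.ne_zero, Int.fract_lt_one _, hi⟩

theorem inv_gaussMap_iterate (h0 : 0 < α) (h1 : α < 1) (hirr : Irrational α) (k : ℕ) :
    (gaussMap^[k] α)⁻¹ = pq α (k + 1) + gaussMap^[k + 1] α := by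
  have h := (gaussMap_iterate_mem h0 h1 hirr k).1
  rw [Function.iterate_succ_apply', gaussMap, pq, Nat.add_sub_cancel,
    natCast_floor_eq_intCast_floor (inv_nonneg.2 h.le), Int.floor_add_fract]

theorem one_le_pq_succ (h0 : 0 < α) (h1 : α < 1) (hirr : Irrational α) (k : ℕ) :
    1 ≤ pq α (k + 1) := by
  obtain ⟨h, h', -⟩ := gaussMap_iterate_mem h0 h1 hirr k
  exact Nat.le_floor (by simpa using (one_lt_inv₀ h).2 h' |>.le)

/-- The product `α · G α ⋯ G^k α` of the Gauss orbit, which is `|q_k α - p_k|`. -/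
noncomputable def gaussProd (α : ℝ) (k : ℕ) : ℝ := ∏ j ∈ Finset.range (k + 1), gaussMap^[j] α

theorem gaussProd_succ_succ (h0 : 0 < α) (h1 : α < 1) (hirr : Irrational α) (k : ℕ) :
    gaussProd α (k + 2) = gaussProd α k - pq α (k + 2) * gaussProd α (k + 1) := by
  have hne := (gaussMap_iterate_mem h0 h1 hirr (k + 1)).1.ne'
  have h : gaussMap^[k + 2] α = (gaussMap^[k + 1] α)⁻¹ - pq α (k + 2) := by
    rw [inv_gaussMap_iterate h0 h1 hirr (k + 1)]
    ring
  have h' : gaussProd α (k + 1) = gaussProd α k * gaussMap^[k + 1] α :=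
    Finset.prod_range_succ _ _
  have h'' : gaussProd α (k + 2) = gaussProd α (k + 1) * gaussMap^[k + 2] α :=
    Finset.prod_range_succ _ _
  rw [h'', h, h']
  field_simp

theorem gaussProd_one (h0 : 0 < α) (h1 : α < 1) (hirr : Irrational α) :
    gaussProd α 1 = 1 - pq α 1 * α := by
  have h := inv_gaussMap_iterate h0 h1 hirr 0
  have e : gaussProd α 1 = α * gaussMap^[1] α := by simp [gaussProd, Finset.prod_range_succ]
  have h' : gaussMap^[1] α = α⁻¹ - pq α 1 := eq_sub_of_add_eq' h.symm
  rw [e, h']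
  field_simp

theorem exists_qden_mul_eq (h0 : 0 < α) (h1 : α < 1) (hirr : Irrational α) (k : ℕ) :
    ∃ p : ℤ, qden α k * α = p + (-1) ^ k * gaussProd α k := by
  induction k using Nat.twoStepInduction with
  | zero => exact ⟨0, by simp [qden, gaussProd]⟩
  | one => exact ⟨1, by rw [gaussProd_one h0 h1 hirr, qden]; push_cast; ring⟩
  | more k ih ih' =>
    obtain ⟨p, hp⟩ := ih
    obtain ⟨p', hp'⟩ := ih'
    refine ⟨pq α (k + 2) * p' + p, ?_⟩
    rw [gaussProd_succ_succ h0 h1 hirr, qden]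
    push_cast
    rw [add_mul, mul_assoc, hp, hp']
    ring

theorem gaussProd_pos (h0 : 0 < α) (h1 : α < 1) (hirr : Irrational α) (k : ℕ) :
    0 < gaussProd α k :=
  Finset.prod_pos fun j _ => (gaussMap_iterate_mem h0 h1 hirr j).1

theorem gaussProd_antitone (h0 : 0 < α) (h1 : α < 1) (hirr : Irrational α) :
    Antitone (gaussProd α) :=
  antitone_nat_of_succ_le fun k => by
    rw [gaussProd, Finset.prod_range_succ]
    exact mul_le_of_le_one_right (gaussProd_pos h0 h1 hirr k).le
      (gaussMap_iterate_mem h0 h1 hirr (k + 1)).2.1.le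

theorem gaussProd_lt_half (h0 : 0 < α) (h1 : α < 1) (hirr : Irrational α) {k : ℕ}
    (hk : 1 ≤ k ∨ 2 ≤ pq α 1) : gaussProd α k < 1 / 2 := by
  have hpos := gaussProd_pos h0 h1 hirr 1
  have hone := gaussProd_one h0 h1 hirr
  rcases hk with hk | hk
  · refine (gaussProd_antitone h0 h1 hirr hk).trans_lt ?_
    have e : gaussProd α 1 = α * gaussMap^[1] α := by simp [gaussProd, Finset.prod_range_succ]
    have hlt : gaussProd α 1 < α := by
      rw [e]
      exact mul_lt_of_lt_one_right h0 (gaussMap_iterate_mem h0 h1 hirr 1).2.1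
    have ha : (1 : ℝ) ≤ pq α 1 := by exact_mod_cast one_le_pq_succ h0 h1 hirr 0
    nlinarith
  · have h : gaussProd α k ≤ α :=
      (gaussProd_antitone h0 h1 hirr k.zero_le).trans_eq (by simp [gaussProd])
    have ha : (2 : ℝ) ≤ pq α 1 := by exact_mod_cast hk
    nlinarith

/-- `q_k α ≡ (-1)^k δ_k` modulo `1`, except possibly when `k = 0` and `a₁ = 1`. -/
theorem exists_qden_mul_eq_dlt (h0 : 0 < α) (h1 : α < 1) (hirr : Irrational α) {k : ℕ}
    (hk : 1 ≤ k ∨ 2 ≤ pq α 1) : ∃ p : ℤ, qden α k * α = p + (-1) ^ k * dlt α k := by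
  obtain ⟨p, hp⟩ := exists_qden_mul_eq h0 h1 hirr k
  refine ⟨p, ?_⟩
  rw [dlt, hp, nint_intCast_add, nint_neg_one_pow_mul (gaussProd_pos h0 h1 hirr k).le
    (gaussProd_lt_half h0 h1 hirr hk)]

end GaussMap

theorem neg_one_pow_mul_eps_div {α : ℝ} (b : ℕ → ℕ) {n i : ℕ} (hi : i ≤ n) (t : ℕ)
    (hq : qden α i ≠ 0) :
    (-1 : ℝ) ^ i * eps α b n i t / qden α i =
      t * ((-1) ^ i * dlt α i) +
        ∑ j ∈ Finset.Ico (i + 1) (n + 1), b j * ((-1) ^ j * dlt α j) := by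
  have hq' : (qden α i : ℝ) ≠ 0 := by exact_mod_cast hq
  have hs : ∑ j ∈ Finset.Ico (i + 1) (n + 1), b j * ((-1 : ℝ) ^ j * dlt α j) =
      ∑ j ∈ Finset.Icc 1 (n - i), b (i + j) * ((-1 : ℝ) ^ (i + j) * dlt α (i + j)) := by
    have h := Finset.sum_Ico_add (fun j => b j * ((-1 : ℝ) ^ j * dlt α j)) 1 (n - i + 1) i
    rw [← Finset.Ico_add_one_right_eq_Icc, h]
    congr 2 <;> omega
  rw [eps, hs, mul_left_comm, mul_div_cancel_left₀ _ hq', mul_add, Finset.mul_sum]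
  congr 1
  · ring
  · exact Finset.sum_congr rfl fun j _ => by ring

/-- Decomposition of the Sudler product into perturbed Sudler products along
the Ostrowski expansion `N = Σ_{ℓ=0}^n b_ℓ q_ℓ`. -/
theorem sudler_ostrowski_decomposition
    (α : ℝ) (h0 : 0 < α) (h1 : α < 1) (hirr : Irrational α)
    (n N : ℕ) (b : ℕ → ℕ)
    (hqN : qden α n ≤ N) (hNq : N < qden α (n + 1))
    (hN : N = ∑ ℓ ∈ Finset.range (n + 1), b ℓ * qden α ℓ)
    (hbn : 1 ≤ b n) (hb0 : b 0 < pq α 1)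
    (hb : ∀ ℓ, 1 ≤ ℓ → ℓ ≤ n → b ℓ ≤ pq α (ℓ + 1))
    (hbz : ∀ ℓ, 1 ≤ ℓ → ℓ ≤ n → b ℓ = pq α (ℓ + 1) → b (ℓ - 1) = 0) :
    sudler α N =
      ∏ i ∈ Finset.range (n + 1), ∏ t ∈ Finset.range (b i),
        sudlerPert α i (eps α b n i t) := by
  rw [sudler, hN, prod_Icc_one_sum_mul]
  refine Finset.prod_congr rfl fun i hi => Finset.prod_congr rfl fun t ht =>
    Finset.prod_congr rfl fun r hr => ?_
  have hin : i ≤ n := Nat.lt_succ_iff.1 (Finset.mem_range.1 hi)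
  have hti : t < b i := Finset.mem_range.1 ht
  have hq : qden α i ≠ 0 := by have := Finset.mem_Icc.1 hr; omega
  have hi' : 1 ≤ i ∨ 2 ≤ pq α 1 := by
    rcases i.eq_zero_or_pos with rfl | h
    · right; omega
    · exact Or.inl h
  obtain ⟨p, hp⟩ := exists_qden_mul_eq_dlt h0 h1 hirr hi'
  have hs : ∃ m : ℤ, ∑ j ∈ Finset.Ico (i + 1) (n + 1), (b j * (qden α j * α) : ℝ) =
      m + ∑ j ∈ Finset.Ico (i + 1) (n + 1), b j * ((-1 : ℝ) ^ j * dlt α j) := by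
    have hex (j : ℕ) : ∃ p : ℤ, 1 ≤ j → qden α j * α = p + (-1) ^ j * dlt α j := by
      by_cases hj : 1 ≤ j
      · obtain ⟨p, hp⟩ := exists_qden_mul_eq_dlt h0 h1 hirr (Or.inl hj)
        exact ⟨p, fun _ => hp⟩
      · exact ⟨0, fun h => absurd h hj⟩
    choose p hp using hex
    refine ⟨∑ j ∈ Finset.Ico (i + 1) (n + 1), b j * p j, ?_⟩
    push_cast
    rw [← Finset.sum_add_distrib]
    refine Finset.sum_congr rfl fun j hj => ?_
    rw [hp j (by have := Finset.mem_Ico.1 hj; omega), mul_add]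
  obtain ⟨m, hm⟩ := hs
  rw [neg_one_pow_mul_eps_div b hin t hq, mul_assoc,
    ← abs_sin_pi_mul_add_intCast (r * α + _) (t * p + m)]
  congr 4
  push_cast
  simp only [add_mul, Finset.sum_mul, mul_assoc]
  rw [hm, hp]
  ring
end

section
/- For every pattern c = (c_1, …, c_9) ∈ {1,2,3}^9 one has ⃖c_max − ⃖c_min < 3/25, where ⃖c_min = [0; c_4, c_3, c_2, c_1, \overline{3,1}] and ⃖c_max = [0; c_4, c_3, c_2, c_1, \overline{1,3}]. -/
/-- `cfval [b₁, …, b_m] t` is the value of the continued fraction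
`[0; b₁, …, b_m, tail]` whose tail `[0; tail]` has value `t`, i.e.
`1/(b₁ + 1/(b₂ + ⋯ + 1/(b_m + t)))`. -/
noncomputable def cfval : List ℕ → ℝ → ℝ
  | [], t => t
  | a :: l, t => ((a : ℝ) + cfval l t)⁻¹

/-- The value `[0; \overline{3,1}] = (√21 - 3)/6`. -/
noncomputable def x31 : ℝ := (Real.sqrt 21 - 3) / 6

/-- The value `[0; \overline{1,3}] = (√21 - 3)/2`. -/
noncomputable def x13 : ℝ := (Real.sqrt 21 - 3) / 2

/-- Truncated continued fractions with partial quotients in `[1, 3]` and tail in `[1/4, 1]`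
stay in `[1/4, 1]`. -/
theorem cfval_mem_Icc (l : List ℕ) (hl : ∀ a ∈ l, a ∈ Set.Icc 1 3) {t : ℝ}
    (ht : t ∈ Set.Icc (1 / 4 : ℝ) 1) : cfval l t ∈ Set.Icc (1 / 4 : ℝ) 1 := by
  induction l with
  | nil => exact ht
  | cons a l ih =>
    obtain ⟨ha, hl⟩ := List.forall_mem_cons.1 hl
    obtain ⟨h₁, h₂⟩ := ih hl
    have ha₁ : (1 : ℝ) ≤ a := mod_cast ha.1
    have ha₃ : (a : ℝ) ≤ 3 := mod_cast ha.2
    constructor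
    · rw [cfval, one_div]
      exact inv_anti₀ (by linarith) (by linarith)
    · exact inv_le_one_of_one_le₀ (by linarith)

/-- Each partial quotient contracts the dependence on the tail by a factor `16/25`. -/
theorem abs_cfval_sub_cfval_le (l : List ℕ) (hl : ∀ a ∈ l, a ∈ Set.Icc 1 3) {s t : ℝ}
    (hs : s ∈ Set.Icc (1 / 4 : ℝ) 1) (ht : t ∈ Set.Icc (1 / 4 : ℝ) 1) :
    |cfval l s - cfval l t| ≤ (16 / 25) ^ l.length * |s - t| := by
  induction l with
  | nil => simp [cfval]
  | cons a l ih =>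
    obtain ⟨ha, hl⟩ := List.forall_mem_cons.1 hl
    have ha₁ : (1 : ℝ) ≤ a := mod_cast ha.1
    have hs' : 5 / 4 ≤ a + cfval l s := by linarith [(cfval_mem_Icc l hl hs).1]
    have ht' : 5 / 4 ≤ a + cfval l t := by linarith [(cfval_mem_Icc l hl ht).1]
    have hprod : 25 / 16 ≤ (a + cfval l s) * (a + cfval l t) := by nlinarith
    rw [cfval, cfval, inv_sub_inv (by linarith) (by linarith), add_sub_add_left_eq_sub, abs_div,
      abs_of_pos (a := _ * _) (by linarith), abs_sub_comm, div_le_iff₀ (by linarith),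
      List.length_cons, pow_succ]
    calc |cfval l s - cfval l t| ≤ (16 / 25) ^ l.length * |s - t| := ih hl
      _ = (16 / 25) ^ l.length * (16 / 25) * |s - t| * (25 / 16) := by ring
      _ ≤ _ := by gcongr

/-- For every pattern `c ∈ {1,2,3}⁹`:
`⃖c_max - ⃖c_min < 3/25`, where `⃖c_min = [0; c₄, c₃, c₂, c₁, \overline{3,1}]` and
`⃖c_max = [0; c₄, c₃, c₂, c₁, \overline{1,3}]`. -/
theorem cev_max_sub_cev_min_lt
    (c : Fin 9 → ℕ) (hc : ∀ i, c i ∈ ({1, 2, 3} : Set ℕ)) :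
    cfval [c 3, c 2, c 1, c 0] x13 - cfval [c 3, c 2, c 1, c 0] x31 < 3 / 25 := by
  have h₁ : 9 / 2 ≤ √21 := Real.le_sqrt_of_sq_le (by norm_num)
  have h₂ : √21 ≤ 5 := Real.sqrt_le_iff.2 (by norm_num)
  have hc' (i : Fin 9) : c i ∈ Set.Icc 1 3 := by
    have := hc i
    simp only [Set.mem_insert_iff, Set.mem_singleton_iff] at this
    exact ⟨by omega, by omega⟩
  have h := abs_cfval_sub_cfval_le [c 3, c 2, c 1, c 0] (by simpa using ⟨hc' 3, hc' 2, hc' 1, hc' 0⟩)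
    (s := x13) (t := x31) ⟨by unfold x13; linarith, by unfold x13; linarith⟩
    ⟨by unfold x31; linarith, by unfold x31; linarith⟩
  have hx : |x13 - x31| ≤ 2 / 3 := by
    unfold x13 x31
    exact abs_le.2 ⟨by linarith, by linarith⟩
  calc _ ≤ _ := le_abs_self _
    _ ≤ (16 / 25) ^ 4 * |x13 - x31| := h
    _ ≤ (16 / 25) ^ 4 * (2 / 3) := by gcongr
    _ < 3 / 25 := by norm_num
end

section
/- Let N, M be integers with 2 ≤ N ≤ M, let c > 0, and let x_n (for N ≤ n ≤ M) be real numbers satisfying |x_n| < 1/2 and |x_n| < c/n for all n. Then ∏_{n=N}^{M} (1 − x_n) ≥ 1 − ( |Σ_{n=N}^{M} x_n| + c²/(N−1) ). -/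
/-- For `|x| < 1/2` one has `exp (-(x + x²)) ≤ 1 - x`. -/
theorem exp_neg_add_sq_le_one_sub {x : ℝ} (hx : |x| < 1 / 2) :
    Real.exp (-(x + x ^ 2)) ≤ 1 - x := by
  have hpos : 0 < 1 - x := by linarith [le_abs_self x]
  rw [← Real.le_log_iff_exp_le hpos]
  have h := neg_le_of_abs_le (Real.abs_log_sub_add_sum_range_le (by linarith : |x| < 1) 4)
  simp only [Finset.sum_range_succ, Finset.sum_range_zero] at h
  norm_num at h
  have hrem : |x| ^ 5 / (1 - |x|) ≤ x ^ 2 / 4 := by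
    rw [div_le_iff₀ (by linarith), ← sq_abs x]
    have hcube : |x| ^ 3 ≤ (1 / 2) ^ 3 := pow_le_pow_left₀ (abs_nonneg x) hx.le 3
    nlinarith [sq_nonneg |x|, mul_le_mul_of_nonneg_left hcube (sq_nonneg |x|),
      mul_nonneg (sq_nonneg |x|) (by linarith : 0 ≤ 1 / 2 - |x|)]
  have hsq : x ^ 2 ≤ 1 / 4 := by
    rw [← sq_abs]
    nlinarith [abs_nonneg x]
  have hthree : x ^ 3 ≤ x ^ 2 / 2 := by
    nlinarith [sq_nonneg x, le_abs_self x]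
  have hfour : x ^ 4 ≤ x ^ 2 / 4 := by nlinarith [sq_nonneg x]
  linarith [sq_nonneg x]

/-- If `2 ≤ N ≤ M`, `c > 0`, and the reals `x_n` (`N ≤ n ≤ M`) satisfy
`|x_n| < 1/2` and `|x_n| < c/n`, then
`∏_{n=N}^{M} (1 - x_n) ≥ 1 - (|Σ_{n=N}^{M} x_n| + c²/(N-1))`. -/
theorem prod_one_sub_ge
    (N M : ℕ) (hN : 2 ≤ N) (hNM : N ≤ M) (c : ℝ) (hc : 0 < c)
    (x : ℕ → ℝ)
    (hx : ∀ n ∈ Finset.Icc N M, |x n| < 1 / 2)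
    (hx' : ∀ n ∈ Finset.Icc N M, |x n| < c / n) :
    1 - (|∑ n ∈ Finset.Icc N M, x n| + c ^ 2 / ((N : ℝ) - 1)) ≤
      ∏ n ∈ Finset.Icc N M, (1 - x n) := by
  have hsum : ∑ n ∈ Finset.Icc N M, x n ^ 2 ≤ c ^ 2 / ((N : ℝ) - 1) := by
    have hIcc : Finset.Icc N M = Finset.Ioc (N - 1) M := by
      ext n
      simp only [Finset.mem_Icc, Finset.mem_Ioc]
      omega
    calc ∑ n ∈ Finset.Icc N M, x n ^ 2
        ≤ ∑ n ∈ Finset.Icc N M, c ^ 2 * ((n : ℝ) ^ 2)⁻¹ := by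
          refine Finset.sum_le_sum fun n hn => ?_
          rw [← div_eq_mul_inv, ← div_pow, ← sq_abs]
          exact pow_le_pow_left₀ (abs_nonneg _) (hx' n hn).le 2
      _ = c ^ 2 * ∑ n ∈ Finset.Ioc (N - 1) M, ((n : ℝ) ^ 2)⁻¹ := by
          rw [Finset.mul_sum, hIcc]
      _ ≤ c ^ 2 * (((N - 1 : ℕ) : ℝ)⁻¹ - (M : ℝ)⁻¹) := by
          gcongr
          exact sum_Ioc_inv_sq_le_sub (by omega) (by omega)
      _ ≤ c ^ 2 / ((N : ℝ) - 1) := by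
          rw [Nat.cast_sub (by omega), Nat.cast_one, div_eq_mul_inv]
          gcongr
          exact sub_le_self _ (by positivity)
  calc 1 - (|∑ n ∈ Finset.Icc N M, x n| + c ^ 2 / ((N : ℝ) - 1))
      ≤ -∑ n ∈ Finset.Icc N M, (x n + x n ^ 2) + 1 := by
        rw [Finset.sum_add_distrib]
        linarith [le_abs_self (∑ n ∈ Finset.Icc N M, x n)]
    _ ≤ Real.exp (-∑ n ∈ Finset.Icc N M, (x n + x n ^ 2)) := Real.add_one_le_exp _
    _ = ∏ n ∈ Finset.Icc N M, Real.exp (-(x n + x n ^ 2)) := by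
        rw [← Finset.sum_neg_distrib, Real.exp_sum]
    _ ≤ ∏ n ∈ Finset.Icc N M, (1 - x n) :=
        Finset.prod_le_prod (fun _ _ => (Real.exp_pos _).le)
          fun n hn => exp_neg_add_sq_le_one_sub (hx n hn)
end
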